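/- arXiv:1306.1810 — 6 statements merged into one kernel-verified Lean document; each statement's English description precedes it below -/
import Mathlib

section
/- Let v ∈ k^{2×n} (n ≥ 2) have uniform matroid of rank 2, i.e. every pair of columns of v is linearly independent. Then the k-dimension of the tensor module G(v) equals (n³ + 5n + 6)/6. -/
noncomputable section

/-- The diagonal action of a matrix `g` on `(k²)^{⊗n}`. -/
def diagAct (k : Type*) [Field k] {r n : ℕ} (g : Matrix (Fin r) (Fin r) k) :
    (PiTensorProduct k fun _ : Fin n => Fin r → k) →ₗ[k]
      (PiTensorProduct k fun _ : Fin n => Fin r → k) :=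
  PiTensorProduct.map fun _ => g.mulVecLin

/-- The decomposable tensor `v₁ ⊗ ⋯ ⊗ v_n` of the columns of `v`. -/
def vtens (k : Type*) [Field k] {r n : ℕ} (v : Matrix (Fin r) (Fin n) k) :
    PiTensorProduct k fun _ : Fin n => Fin r → k :=
  PiTensorProduct.tprod k fun j => fun i => v i j

/-- The tensor module `G(v)`. -/
def tensMod (k : Type*) [Field k] {r n : ℕ} (v : Matrix (Fin r) (Fin n) k) :
    Submodule k (PiTensorProduct k fun _ : Fin n => Fin r → k) :=
  Submodule.span k {x | ∃ g : (Matrix (Fin r) (Fin r) k)ˣ, x = diagAct k g.1 (vtens k v)}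

open MvPolynomial

section TensorModule

variable {k : Type*} [Field k] {ι : Type*}

/-- The `r`-th coordinate of `g • v_i`, as a polynomial in the entries of the generic matrix `g`. -/
def genericEntry (v : Matrix (Fin 2) ι k) (i : ι) (r : Fin 2) : MvPolynomial (Fin 2 × Fin 2) k :=
  C (v 0 i) * X (r, 0) + C (v 1 i) * X (r, 1)

/-- The determinant of the generic `2 × 2` matrix. -/
def genericDet (k : Type*) [Field k] : MvPolynomial (Fin 2 × Fin 2) k :=
  X (0, 0) * X (1, 1) - X (0, 1) * X (1, 0)

lemma genericDet_ne_zero : genericDet k ≠ 0 := by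
  intro h
  have := congrArg (eval fun e : Fin 2 × Fin 2 => if e.1 = e.2 then (1 : k) else 0) h
  simp [genericDet] at this

lemma genericEntry_mul_sub_mul (v : Matrix (Fin 2) ι k) (i j : ι) :
    genericEntry v i 0 * genericEntry v j 1 - genericEntry v i 1 * genericEntry v j 0 =
      C (v 0 i * v 1 j - v 1 i * v 0 j) * genericDet k := by
  simp only [genericEntry, genericDet, C_mul, C_sub]
  ring

lemma isHomogeneous_genericEntry (v : Matrix (Fin 2) ι k) (i : ι) (r : Fin 2) :
    (genericEntry v i r).IsHomogeneous 1 :=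
  (isHomogeneous_C_mul_X _ _).add (isHomogeneous_C_mul_X _ _)

/-- The span of the products of `m` generic entries, at most one for each column in `I`. -/
def entryProducts (v : Matrix (Fin 2) ι k) (I : Finset ι) (m : ℕ) :
    Submodule k (MvPolynomial (Fin 2 × Fin 2) k) :=
  Submodule.span k
    {p | ∃ S ⊆ I, ∃ c : ι → Fin 2, S.card = m ∧ p = ∏ i ∈ S, genericEntry v i (c i)}

lemma mul_genericEntry_mem_entryProducts [DecidableEq ι] (v : Matrix (Fin 2) ι k) {I : Finset ι}
    {m : ℕ} {i : ι} (hi : i ∈ I) (r : Fin 2) {p : MvPolynomial (Fin 2 × Fin 2) k}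
    (hp : p ∈ entryProducts v (I.erase i) m) :
    p * genericEntry v i r ∈ entryProducts v I (m + 1) := by
  suffices entryProducts v (I.erase i) m ≤
      (entryProducts v I (m + 1)).comap (LinearMap.mulRight k (genericEntry v i r)) from this hp
  rw [entryProducts, Submodule.span_le]
  rintro _ ⟨S, hS, c, rfl, rfl⟩
  have hiS : i ∉ S := fun h => (Finset.mem_erase.1 (hS h)).1 rfl
  refine Submodule.subset_span ⟨insert i S, ?_, Function.update c i r, ?_, ?_⟩
  · exact Finset.insert_subset hi (hS.trans (Finset.erase_subset _ _))
  · simp [hiS]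
  · rw [Finset.prod_insert hiS, LinearMap.mulRight_apply, mul_comm, Function.update_self]
    congr 1
    refine Finset.prod_congr rfl fun j hj => ?_
    rw [Function.update_of_ne (ne_of_mem_of_not_mem hj hiS)]

lemma homogeneousSubmodule_le_entryProducts [DecidableEq ι] (v : Matrix (Fin 2) ι k)
    (hv : ∀ i j, i ≠ j → v 0 i * v 1 j - v 1 i * v 0 j ≠ 0) (m : ℕ) (I : Finset ι)
    (hI : m < I.card) :
    homogeneousSubmodule (Fin 2 × Fin 2) k m ≤ entryProducts v I m := by
  induction m generalizing I with
  | zero =>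
    rw [← homogeneousSubmodule_one_pow, pow_zero, Submodule.one_eq_span, Submodule.span_le,
      Set.singleton_subset_iff]
    exact Submodule.subset_span ⟨∅, by simp, 0, by simp⟩
  | succ m ih =>
    obtain ⟨i, hi, j, hj, hij⟩ := Finset.one_lt_card.1 (show 1 < I.card by omega)
    rw [← homogeneousSubmodule_one_pow, pow_succ, homogeneousSubmodule_one_pow,
      homogeneousSubmodule_one_eq_span_X, Submodule.mul_le]
    intro p hp q hq
    have key : ∀ r, ∀ l ∈ I, p * genericEntry v l r ∈ entryProducts v I (m + 1) := fun r l hl =>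
      mul_genericEntry_mem_entryProducts v hl r
        (ih (I.erase l) (by rw [Finset.card_erase_of_mem hl]; omega) hp)
    suffices Submodule.span k (Set.range X) ≤
        (entryProducts v I (m + 1)).comap (LinearMap.mulLeft k p) from this hq
    rw [Submodule.span_le]
    rintro _ ⟨⟨r, s⟩, rfl⟩
    change p * X (r, s) ∈ entryProducts v I (m + 1)
    rw [← Submodule.smul_mem_iff _ (hv i j hij)]
    fin_cases s
    · convert sub_mem (Submodule.smul_mem _ (v 1 j) (key r i hi))
        (Submodule.smul_mem _ (v 1 i) (key r j hj)) using 1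
      simp only [genericEntry, smul_eq_C_mul, C_mul, C_sub, Fin.zero_eta]
      ring
    · convert sub_mem (Submodule.smul_mem _ (v 0 i) (key r j hj))
        (Submodule.smul_mem _ (v 0 j) (key r i hi)) using 1
      simp only [genericEntry, smul_eq_C_mul, C_mul, C_sub, Fin.mk_one]
      ring

lemma finrank_homogeneousSubmodule (σ : Type*) [Fintype σ] (m : ℕ) :
    Module.finrank k (homogeneousSubmodule σ k m) = (Fintype.card σ).multichoose m := by
  classical
  rw [homogeneousSubmodule_eq_finsupp_supported,
    (AddMonoidAlgebra.supportedEquivFinsupp {d : σ →₀ ℕ | d.degree = m}).finrank_eq]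
  have e : Sym σ m ≃ {d : σ →₀ ℕ | d.degree = m} := Sym.equivNatSum σ m
  have := Fintype.ofEquiv _ e
  rw [Module.finrank_finsupp_self, ← Fintype.card_congr e, Sym.card_sym_eq_multichoose]

/-- Restriction to the matrices with rows `T • x` and `x`, on which the determinant vanishes. -/
def rankOneRestrict (k : Type*) [Field k] :
    MvPolynomial (Fin 2 × Fin 2) k →ₐ[k] Polynomial (MvPolynomial (Fin 2) k) :=
  aeval fun e => (if e.1 = 0 then Polynomial.X else 1) * Polynomial.C (X e.2)

lemma rankOneRestrict_genericDet : rankOneRestrict k (genericDet k) = 0 := by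
  simp [rankOneRestrict, genericDet]
  ring

lemma rankOneRestrict_genericEntry (v : Matrix (Fin 2) ι k) (i : ι) (r : Fin 2) :
    rankOneRestrict k (genericEntry v i r) = (if r = 0 then Polynomial.X else 1) *
      Polynomial.C (C (v 0 i) * X 0 + C (v 1 i) * X 1) := by
  simp only [rankOneRestrict, genericEntry, map_add, map_mul, aeval_X, algHom_C,
    Polynomial.algebraMap_apply, MvPolynomial.algebraMap_eq]
  ring

variable [Fintype ι]

/-- The coordinate of `g • v^⊗` at the basis tensor `e_{c 1} ⊗ ⋯ ⊗ e_{c n}`, as a polynomial in the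
entries of the generic matrix `g`. -/
def genericCoord (v : Matrix (Fin 2) ι k) (c : ι → Fin 2) : MvPolynomial (Fin 2 × Fin 2) k :=
  ∏ i, genericEntry v i (c i)

/-- The forms of degree `#ι` that are divisible by the generic determinant. -/
def detMultiples (k : Type*) [Field k] (ι : Type*) [Fintype ι] :
    Submodule k (MvPolynomial (Fin 2 × Fin 2) k) :=
  (homogeneousSubmodule (Fin 2 × Fin 2) k (Fintype.card ι - 2)).map
    (LinearMap.mulLeft k (genericDet k))

lemma genericCoord_eq_mul [DecidableEq ι] (v : Matrix (Fin 2) ι k) (c : ι → Fin 2) {i j : ι}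
    (hij : i ≠ j) :
    genericCoord v c = genericEntry v i (c i) * genericEntry v j (c j) *
      ∏ l ∈ ({i, j} : Finset ι)ᶜ, genericEntry v l (c l) := by
  rw [genericCoord, ← Finset.prod_mul_prod_compl {i, j}, Finset.prod_pair hij]

lemma card_compl_pair [DecidableEq ι] {i j : ι} (hij : i ≠ j) :
    ({i, j} : Finset ι)ᶜ.card = Fintype.card ι - 2 := by
  rw [Finset.card_compl, Finset.card_pair hij]

lemma genericCoord_comp_swap_sub_mem [DecidableEq ι] (v : Matrix (Fin 2) ι k) (c : ι → Fin 2)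
    {i j : ι} (hij : i ≠ j) :
    genericCoord v (c ∘ Equiv.swap i j) - genericCoord v c ∈ detMultiples k ι := by
  have hprod : ∏ l ∈ ({i, j} : Finset ι)ᶜ, genericEntry v l ((c ∘ Equiv.swap i j) l) =
      ∏ l ∈ ({i, j} : Finset ι)ᶜ, genericEntry v l (c l) := by
    refine Finset.prod_congr rfl fun l hl => ?_
    simp only [Finset.mem_compl, Finset.mem_insert, Finset.mem_singleton, not_or] at hl
    rw [Function.comp_apply, Equiv.swap_apply_of_ne_of_ne hl.1 hl.2]
  rw [genericCoord_eq_mul v _ hij, genericCoord_eq_mul v c hij, hprod]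
  set P := ∏ l ∈ ({i, j} : Finset ι)ᶜ, genericEntry v l (c l)
  have hhom : P ∈ homogeneousSubmodule (Fin 2 × Fin 2) k (Fintype.card ι - 2) := by
    have := IsHomogeneous.prod ({i, j} : Finset ι)ᶜ (fun l => genericEntry v l (c l)) (fun _ => 1)
      fun l _ => isHomogeneous_genericEntry v l (c l)
    rwa [Finset.sum_const, smul_eq_mul, mul_one, card_compl_pair hij] at this
  have hmem : ∀ a : k, C a * genericDet k * P ∈ detMultiples k ι := fun a =>
    ⟨a • P, Submodule.smul_mem _ a hhom, by rw [LinearMap.mulLeft_apply, smul_eq_C_mul]; ring⟩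
  have h := genericEntry_mul_sub_mul v i j
  simp only [Function.comp_apply, Equiv.swap_apply_left, Equiv.swap_apply_right, ← sub_mul]
  have h01 : ∀ r : Fin 2, r = 0 ∨ r = 1 := by decide
  rcases h01 (c i) with hi | hi <;> rcases h01 (c j) with hj | hj <;> rw [hi, hj]
  · simp
  · convert neg_mem (hmem (v 0 i * v 1 j - v 1 i * v 0 j)) using 1
    rw [← h]; ring
  · convert hmem (v 0 i * v 1 j - v 1 i * v 0 j) using 1
    rw [← h]
  · simp

lemma genericCoord_comp_perm_sub_mem (v : Matrix (Fin 2) ι k) (c : ι → Fin 2)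
    (e : Equiv.Perm ι) : genericCoord v (c ∘ e) - genericCoord v c ∈ detMultiples k ι := by
  classical
  induction e using Equiv.Perm.swap_induction_on generalizing c with
  | one => simp
  | swap_mul f x y hxy ih =>
    have := add_mem (ih (c ∘ Equiv.swap x y)) (genericCoord_comp_swap_sub_mem v c hxy)
    rwa [sub_add_sub_cancel] at this

/-- The number of indices at which `c` takes the value `0`. -/
def zeroCount (c : ι → Fin 2) : ℕ := (Finset.univ.filter fun i => c i = 0).card

lemma exists_perm_of_zeroCount_eq (c c' : ι → Fin 2) (h : zeroCount c = zeroCount c') :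
    ∃ e : Equiv.Perm ι, c = c' ∘ e := by
  classical
  have h0 : Fintype.card {i // c i = 0} = Fintype.card {i // c' i = 0} := by
    simpa only [zeroCount, Fintype.card_subtype] using h
  have h1 : Fintype.card {i // c i = 1} = Fintype.card {i // c' i = 1} := by
    have h01 : ∀ r : Fin 2, ¬r = 0 ↔ r = 1 := by decide
    have := Fintype.card_compl_eq_card_compl _ _ h0
    simpa only [h01] using this
  have e : ∀ y : Fin 2, Nonempty ({i // c i = y} ≃ {i // c' i = y}) := by
    rw [Fin.forall_fin_two]
    exact ⟨⟨Fintype.equivOfCardEq h0⟩, ⟨Fintype.equivOfCardEq h1⟩⟩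
  exact ⟨Equiv.ofFiberEquiv fun y => (e y).some,
    funext fun i => (Equiv.ofFiberEquiv_map _ i).symm⟩

lemma exists_zeroCount_eq {s : ℕ} (hs : s ≤ Fintype.card ι) :
    ∃ c : ι → Fin 2, zeroCount c = s := by
  classical
  obtain ⟨S, -, hS⟩ := Finset.exists_subset_card_eq (s := (Finset.univ : Finset ι)) hs
  refine ⟨fun i => if i ∈ S then 0 else 1, ?_⟩
  rw [zeroCount, ← hS]
  congr 1
  ext i
  simp

lemma rankOneRestrict_genericCoord (v : Matrix (Fin 2) ι k) (c : ι → Fin 2) :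
    rankOneRestrict k (genericCoord v c) = Polynomial.X ^ zeroCount c *
      Polynomial.C (∏ i, (C (v 0 i) * X 0 + C (v 1 i) * X 1)) := by
  simp only [genericCoord, map_prod, rankOneRestrict_genericEntry, Finset.prod_mul_distrib]
  rw [Finset.prod_ite, Finset.prod_const, Finset.prod_const_one, mul_one, zeroCount]

lemma prod_linearForm_ne_zero (v : Matrix (Fin 2) ι k) (hv : ∀ i, v 0 i ≠ 0 ∨ v 1 i ≠ 0) :
    ∏ i, (C (v 0 i) * X 0 + C (v 1 i) * X 1 : MvPolynomial (Fin 2) k) ≠ 0 := by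
  refine Finset.prod_ne_zero_iff.2 fun i _ h => ?_
  have h0 := congrArg (eval ![1, 0]) h
  have h1 := congrArg (eval ![0, 1]) h
  simp at h0 h1
  exact (hv i).elim (· h0) (· h1)

lemma linearIndependent_rankOneRestrict (v : Matrix (Fin 2) ι k)
    (hv : ∀ i, v 0 i ≠ 0 ∨ v 1 i ≠ 0) {N : ℕ} (c : Fin N → ι → Fin 2)
    (hc : ∀ s, zeroCount (c s) = s) :
    LinearIndependent k fun s => rankOneRestrict k (genericCoord v (c s)) := by
  rw [Fintype.linearIndependent_iff]
  intro a ha s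
  have h := congrArg (fun p => p.coeff (s : ℕ)) ha
  simp only [rankOneRestrict_genericCoord, hc, Polynomial.finsetSum_coeff, Polynomial.coeff_smul,
    Polynomial.coeff_X_pow_mul', Polynomial.coeff_C] at h
  rw [Finset.sum_eq_single s] at h
  · simpa [prod_linearForm_ne_zero v hv] using h
  · intro t _ hts
    have : (t : ℕ) ≠ s := fun h => hts (Fin.ext h)
    split_ifs <;> first | omega | simp
  · simp

lemma detMultiples_le_span (v : Matrix (Fin 2) ι k)
    (hv : ∀ i j, i ≠ j → v 0 i * v 1 j - v 1 i * v 0 j ≠ 0) (hι : 2 ≤ Fintype.card ι) :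
    detMultiples k ι ≤ Submodule.span k (Set.range (genericCoord v)) := by
  classical
  refine (Submodule.map_mono (homogeneousSubmodule_le_entryProducts v hv _ Finset.univ
    (by rw [Finset.card_univ]; omega))).trans ?_
  rw [Submodule.map_le_iff_le_comap, entryProducts, Submodule.span_le]
  rintro _ ⟨S, -, c, hS, rfl⟩
  have hScompl : Sᶜ.card = 2 := by rw [Finset.card_compl, hS]; omega
  obtain ⟨i, j, hij, hSij⟩ := Finset.card_eq_two.1 hScompl
  obtain rfl : S = {i, j}ᶜ := by rw [← hSij, compl_compl]
  have hupd : ∀ r s : Fin 2, genericCoord v (Function.update (Function.update c i r) j s) =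
      genericEntry v i r * genericEntry v j s *
        ∏ l ∈ ({i, j} : Finset ι)ᶜ, genericEntry v l (c l) := by
    intro r s
    rw [genericCoord_eq_mul v _ hij, Function.update_self, Function.update_of_ne hij,
      Function.update_self]
    congr 1
    refine Finset.prod_congr rfl fun l hl => ?_
    simp only [Finset.mem_compl, Finset.mem_insert, Finset.mem_singleton, not_or] at hl
    rw [Function.update_of_ne hl.2, Function.update_of_ne hl.1]
  simp only [Submodule.comap_coe, Set.mem_preimage, SetLike.mem_coe, LinearMap.mulLeft_apply]
  rw [← Submodule.smul_mem_iff _ (hv i j hij), smul_eq_C_mul, ← mul_assoc,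
    ← genericEntry_mul_sub_mul, sub_mul, ← hupd, ← hupd]
  exact sub_mem (Submodule.subset_span ⟨_, rfl⟩) (Submodule.subset_span ⟨_, rfl⟩)

lemma span_genericCoord_eq_sup (v : Matrix (Fin 2) ι k)
    (hv : ∀ i j, i ≠ j → v 0 i * v 1 j - v 1 i * v 0 j ≠ 0) (hι : 2 ≤ Fintype.card ι)
    (c : Fin (Fintype.card ι + 1) → ι → Fin 2) (hc : ∀ s, zeroCount (c s) = s) :
    Submodule.span k (Set.range (genericCoord v)) =
      Submodule.span k (Set.range fun s => genericCoord v (c s)) ⊔ detMultiples k ι := by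
  apply le_antisymm
  · rw [Submodule.span_le]
    rintro _ ⟨d, rfl⟩
    have hd : zeroCount d < Fintype.card ι + 1 := Nat.lt_succ_of_le (Finset.card_le_univ _)
    obtain ⟨e, he⟩ := exists_perm_of_zeroCount_eq d (c ⟨_, hd⟩) (hc ⟨_, hd⟩).symm
    have := Submodule.add_mem_sup
      (Submodule.subset_span (R := k) (Set.mem_range_self (f := fun s => genericCoord v (c s)) ⟨_, hd⟩))
      (genericCoord_comp_perm_sub_mem v (c ⟨_, hd⟩) e)
    rwa [add_sub_cancel, ← he] at this
  · refine sup_le (Submodule.span_mono ?_) (detMultiples_le_span v hv hι)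
    rintro _ ⟨s, rfl⟩
    exact ⟨_, rfl⟩

lemma finrank_detMultiples :
    Module.finrank k (detMultiples k ι) = Nat.multichoose 4 (Fintype.card ι - 2) := by
  have hinj : Function.Injective (LinearMap.mulLeft k (genericDet k)) :=
    mul_right_injective₀ genericDet_ne_zero
  rw [detMultiples, ← (Submodule.equivMapOfInjective _ hinj _).finrank_eq,
    finrank_homogeneousSubmodule]
  simp

lemma detMultiples_le_ker :
    detMultiples k ι ≤ LinearMap.ker (rankOneRestrict k).toLinearMap := by
  rintro _ ⟨p, -, rfl⟩
  simp [rankOneRestrict_genericDet]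

lemma finrank_span_genericCoord (v : Matrix (Fin 2) ι k)
    (hv : ∀ i j, i ≠ j → v 0 i * v 1 j - v 1 i * v 0 j ≠ 0) (hι : 2 ≤ Fintype.card ι) :
    Module.finrank k (Submodule.span k (Set.range (genericCoord v))) =
      Fintype.card ι + 1 + Nat.multichoose 4 (Fintype.card ι - 2) := by
  choose c hc using fun s : Fin (Fintype.card ι + 1) =>
    exists_zeroCount_eq (ι := ι) (Nat.le_of_lt_succ s.2)
  have hv0 : ∀ i, v 0 i ≠ 0 ∨ v 1 i ≠ 0 := by
    intro i
    have : Nontrivial ι := Fintype.one_lt_card_iff_nontrivial.1 hι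
    obtain ⟨j, hj⟩ := exists_ne i
    by_contra! h
    exact hv i j hj.symm (by simp [h])
  have hli := linearIndependent_rankOneRestrict v hv0 c hc
  have hdisj := (Submodule.range_ker_disjoint
    (f := (rankOneRestrict k).toLinearMap) (v := fun s => genericCoord v (c s)) hli).mono_right
      (detMultiples_le_ker (ι := ι))
  have : FiniteDimensional k (detMultiples k ι) :=
    Module.Finite.iff_fg.2 ((homogeneousSubmodule_fg _ _ _).map _)
  have : FiniteDimensional k (Submodule.span k (Set.range fun s => genericCoord v (c s))) :=
    FiniteDimensional.span_of_finite k (Set.finite_range _)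
  have hsum := Submodule.finrank_sup_add_finrank_inf_eq
    (Submodule.span k (Set.range fun s => genericCoord v (c s))) (detMultiples k ι)
  rw [hdisj.eq_bot, finrank_bot, add_zero, ← span_genericCoord_eq_sup v hv hι c hc,
    finrank_detMultiples,
    finrank_span_eq_card (LinearIndependent.of_comp (rankOneRestrict k).toLinearMap hli),
    Fintype.card_fin] at hsum
  exact hsum

lemma eq_zero_of_eval_units [Infinite k] {p : MvPolynomial (Fin 2 × Fin 2) k}
    (h : ∀ g : (Matrix (Fin 2) (Fin 2) k)ˣ, eval (fun e => g.1 e.1 e.2) p = 0) : p = 0 := by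
  refine (mul_eq_zero.1 (MvPolynomial.funext fun x => ?_)).resolve_left
    (genericDet_ne_zero (k := k))
  by_cases hx : (Matrix.of fun i j => x (i, j)).det = 0
  · rw [Matrix.det_fin_two] at hx
    simp only [Matrix.of_apply] at hx
    simp [genericDet, hx]
  · rw [map_mul, map_zero]
    exact mul_eq_zero_of_right _
      (h (Matrix.GeneralLinearGroup.mkOfDetNeZero (Matrix.of fun i j => x (i, j)) hx))

end TensorModule

/-- The basis of `(k²)^{⊗n}` formed by the tensor products of the standard basis vectors. -/
def tensorBasis (k : Type*) [Field k] (n : ℕ) :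
    Module.Basis (Fin n → Fin 2) k (PiTensorProduct k fun _ : Fin n => Fin 2 → k) :=
  Basis.piTensorProduct fun _ => Pi.basisFun k (Fin 2)

lemma tensorBasis_repr_diagAct {k : Type*} [Field k] {n : ℕ} (v : Matrix (Fin 2) (Fin n) k)
    (g : Matrix (Fin 2) (Fin 2) k) (c : Fin n → Fin 2) :
    (tensorBasis k n).repr (diagAct k g (vtens k v)) c =
      eval (fun e => g e.1 e.2) (genericCoord v c) := by
  rw [tensorBasis, diagAct, vtens, PiTensorProduct.map_tprod, Basis.piTensorProduct_repr_tprod_apply,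
    genericCoord, map_prod]
  refine Finset.prod_congr rfl fun i _ => ?_
  rw [Pi.basisFun_repr, Matrix.mulVecLin_apply, Matrix.mulVec, dotProduct, Fin.sum_univ_two]
  simp [genericEntry, mul_comm]

lemma finrank_tensMod {k : Type*} [Field k] [Infinite k] {n : ℕ} (v : Matrix (Fin 2) (Fin n) k) :
    Module.finrank k (tensMod k v) =
      Module.finrank k (Submodule.span k (Set.range (genericCoord v))) := by
  have : FiniteDimensional k (PiTensorProduct k fun _ : Fin n => Fin 2 → k) :=
    (tensorBasis k n).finiteDimensional_of_finite
  set Φ : Module.Dual k (PiTensorProduct k fun _ : Fin n => Fin 2 → k) →ₗ[k]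
      MvPolynomial (Fin 2 × Fin 2) k :=
    (tensorBasis k n).dualBasis.constr k (genericCoord v) with hΦ
  have hrange : LinearMap.range Φ = Submodule.span k (Set.range (genericCoord v)) :=
    Module.Basis.constr_range _ _
  have heval : ∀ φ (g : Matrix (Fin 2) (Fin 2) k),
      eval (fun e => g e.1 e.2) (Φ φ) = φ (diagAct k g (vtens k v)) := by
    intro φ g
    rw [← (tensorBasis k n).sum_repr (diagAct k g (vtens k v)), map_sum, hΦ,
      Module.Basis.constr_apply_fintype, map_sum]
    refine Finset.sum_congr rfl fun c _ => ?_
    rw [smul_eval, map_smul, tensorBasis_repr_diagAct, Module.Basis.equivFun_apply,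
      Module.Basis.dualBasis_repr, smul_eq_mul, mul_comm]
  have hker : LinearMap.ker Φ = (tensMod k v).dualAnnihilator := by
    ext φ
    rw [LinearMap.mem_ker, Submodule.mem_dualAnnihilator]
    constructor
    · intro h
      suffices tensMod k v ≤ LinearMap.ker φ from fun w hw => this hw
      rw [tensMod, Submodule.span_le]
      rintro _ ⟨g, rfl⟩
      rw [SetLike.mem_coe, LinearMap.mem_ker, ← heval, h, map_zero]
    · intro h
      refine eq_zero_of_eval_units fun g => ?_
      rw [heval]
      exact h _ (Submodule.subset_span ⟨g, rfl⟩)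
  have h1 := LinearMap.finrank_range_add_finrank_ker Φ
  have h2 := Subspace.finrank_add_finrank_dualAnnihilator_eq (tensMod k v)
  rw [Subspace.dual_finrank_eq, hrange, hker] at h1
  omega

lemma add_one_add_multichoose_four {n : ℕ} (hn : 2 ≤ n) :
    n + 1 + Nat.multichoose 4 (n - 2) = (n ^ 3 + 5 * n + 6) / 6 := by
  obtain ⟨m, rfl⟩ := Nat.exists_eq_add_of_le' hn
  have h : 6 * (m + 3).choose 3 = (m + 3) * (m + 2) * (m + 1) := by
    have := Nat.descFactorial_eq_factorial_mul_choose (m + 3) 3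
    rw [show Nat.factorial 3 = 6 from rfl] at this
    rw [← this]
    simp only [Nat.descFactorial_succ, Nat.descFactorial_zero, Nat.sub_zero]
    rw [show m + 3 - 2 = m + 1 by omega, show m + 3 - 1 = m + 2 by omega]
    ring
  rw [Nat.add_sub_cancel, Nat.multichoose_eq, show 4 + m - 1 = m + 3 by omega,
    Nat.choose_symm_add]
  refine (Nat.div_eq_of_eq_mul_right (by norm_num) ?_).symm
  rw [mul_add 6 (m + 2 + 1), h]
  ring

/-- For `v ∈ k^{2×n}` with uniform matroid of rank 2, the dimension of the tensor
module `G(v)` is `(n³ + 5n + 6)/6`. -/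
theorem dimension_of_tensor_module_uniform_rank_two
    {k : Type*} [Field k] [CharZero k] {n : ℕ} (hn : 2 ≤ n)
    (v : Matrix (Fin 2) (Fin n) k)
    (huni : ∀ j j' : Fin n, j ≠ j' →
      LinearIndependent k ![fun i => v i j, fun i => v i j']) :
    Module.finrank k ↥(tensMod k v) = (n ^ 3 + 5 * n + 6) / 6 := by
  have hv : ∀ i j, i ≠ j → v 0 i * v 1 j - v 1 i * v 0 j ≠ 0 := by
    intro i j hij h
    have hunit := (Matrix.linearIndependent_rows_iff_isUnit
      (A := Matrix.of ![fun r => v r i, fun r => v r j])).1 (huni i j hij)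
    rw [Matrix.isUnit_iff_isUnit_det, isUnit_iff_ne_zero, Matrix.det_fin_two] at hunit
    exact hunit (by simpa using h)
  rw [finrank_tensMod, finrank_span_genericCoord v hv (by simpa using hn), Fintype.card_fin,
    add_one_add_multichoose_four hn]
end
end

section
/- Let v ∈ k^{2×n} have rank 2 with no zero column. Partition {1,…,n} into parallel classes, where i and j lie in the same class iff v_i and v_j are linearly dependent, and for m ≥ 1 let μ'_m denote the number of parallel classes of size at least m (so μ' is the conjugate of the parallelism partition μ of v). Then for a, b ∈ k^×, the trace of the endomorphism of G(v) induced by diag(a,b) equals ∑_{i=0}^{n} a^i b^{n−i} + ∑_{ℓ=1}^{⌊n/2⌋} max(μ'_1 + ⋯ + μ'_ℓ − 2ℓ + 1, 0) · ∑_{i=ℓ}^{n−ℓ} a^i b^{n−i}. -/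
noncomputable section

open scoped Classical

/-- The parallel class of the column `j` of `v ∈ k^{2×n}`: all columns parallel
to it. -/
def parClass (k : Type*) [Field k] {n : ℕ} (v : Matrix (Fin 2) (Fin n) k) (j : Fin n) :
    Finset (Fin n) :=
  Finset.univ.filter fun j' => ¬ LinearIndependent k ![fun i => v i j, fun i => v i j']

/-- `μ'_m`: the number of parallel classes of `v` of size at least `m` (the conjugate
of the parallelism partition of `v`). -/
def parConj (k : Type*) [Field k] {n : ℕ} (v : Matrix (Fin 2) (Fin n) k) (m : ℕ) : ℕ :=
  ((Finset.univ.image (parClass k v)).filter fun s => m ≤ s.card).card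

namespace TensorCharacter

open Polynomial

section Mixed

variable {k ι : Type*} [Field k] [DecidableEq ι] (r : ι → k)

/-- The product of the linear forms `X - r j` over `j ∈ S` and `Y - r j` over `j ∈ T`. -/
def mixedProd (S T : Finset ι) : k[X][X] :=
  (∏ j ∈ S, (X - C (C (r j)))) * C (∏ j ∈ T, (X - C (r j)))

/-- The span of all mixed products indexed by the splittings of `U` with `i` elements
assigned to `X` and the others to `Y`. -/
def mixedSpan (U : Finset ι) (i : ℕ) : Submodule k k[X][X] :=
  Submodule.span k {F | ∃ S ⊆ U, S.card = i ∧ F = mixedProd r S (U \ S)}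

lemma mixedProd_mem {U S : Finset ι} (hS : S ⊆ U) :
    mixedProd r S (U \ S) ∈ mixedSpan r U S.card :=
  Submodule.subset_span ⟨S, hS, rfl, rfl⟩

lemma mul_mem_mixedSpan_insert_insert {U : Finset ι} {i : ℕ} {j j' : ι} (hj : j ∉ U)
    (hj' : j' ∉ U) (hr : r j ≠ r j') {F : k[X][X]} (hF : F ∈ mixedSpan r U i) :
    (X - C X) * F ∈ mixedSpan r (insert j (insert j' U)) (i + 1) := by
  have hne : j ≠ j' := fun h => hr (congrArg r h)
  suffices h : mixedSpan r U i ≤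
      (mixedSpan r (insert j (insert j' U)) (i + 1)).comap (LinearMap.mulLeft k (X - C X)) from h hF
  refine Submodule.span_le.2 ?_
  rintro _ ⟨S, hS, rfl, rfl⟩
  have hjS : j ∉ S := fun h => hj (hS h)
  have hjS' : j' ∉ S := fun h => hj' (hS h)
  have h1 : insert j (insert j' U) \ insert j S = insert j' (U \ S) := by
    ext x; simp only [Finset.mem_sdiff, Finset.mem_insert]; grind
  have h2 : insert j (insert j' U) \ insert j' S = insert j (U \ S) := by
    ext x; simp only [Finset.mem_sdiff, Finset.mem_insert]; grind
  have m1 := mixedProd_mem r (U := insert j (insert j' U)) (S := insert j S)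
    (Finset.insert_subset_insert _ (hS.trans (Finset.subset_insert _ _)))
  have m2 := mixedProd_mem r (U := insert j (insert j' U)) (S := insert j' S)
    ((Finset.insert_subset_insert _ hS).trans (Finset.subset_insert _ _))
  rw [Finset.card_insert_of_notMem hjS, h1] at m1
  rw [Finset.card_insert_of_notMem hjS', h2] at m2
  have h3 : (X - C X) * mixedProd r S (U \ S) = (r j - r j')⁻¹ •
      (mixedProd r (insert j S) (insert j' (U \ S)) -
        mixedProd r (insert j' S) (insert j (U \ S))) := by
    rw [eq_inv_smul_iff₀ (sub_ne_zero.2 hr), Algebra.smul_def]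
    have : algebraMap k k[X][X] (r j - r j') = C (C (r j)) - C (C (r j')) := by
      simp [Polynomial.algebraMap_apply]
    rw [this]
    unfold mixedProd
    rw [Finset.prod_insert hjS, Finset.prod_insert hjS',
      Finset.prod_insert (by simp [hj']), Finset.prod_insert (by simp [hj])]
    simp only [C_mul, C_sub]
    ring
  rw [SetLike.mem_coe, Submodule.mem_comap, LinearMap.mulLeft_apply, h3]
  exact Submodule.smul_mem _ _ (Submodule.sub_mem _ m1 m2)

omit [Field k] in
lemma exists_pair_card_filter_erase_le {Q : Finset ι} {l : ℕ} (hQ : Q.card = 2 * (l + 1))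
    (hcl : ∀ ρ, (Q.filter fun j => r j = ρ).card ≤ l + 1) :
    ∃ j ∈ Q, ∃ j' ∈ Q, r j ≠ r j' ∧
      ∀ ρ, (((Q.erase j).erase j').filter fun x => r x = ρ).card ≤ l := by
  have hne : Q.Nonempty := Finset.card_pos.1 (by omega)
  obtain ⟨j, hj, hmax⟩ :=
    Q.exists_max_image (fun j => (Q.filter fun x => r x = r j).card) hne
  have hsplit := Q.card_filter_add_card_filter_not (fun x => r x = r j)
  have hne' : (Q.filter fun x => ¬ r x = r j).Nonempty := by
    have := hcl (r j)
    exact Finset.card_pos.1 (by omega)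
  obtain ⟨j', hj', hmax'⟩ := (Q.filter fun x => ¬ r x = r j).exists_max_image
    (fun j => (Q.filter fun x => r x = r j).card) hne'
  rw [Finset.mem_filter] at hj'
  refine ⟨j, hj, j', hj'.1, fun h => hj'.2 h.symm, fun ρ => ?_⟩
  rw [Finset.filter_erase, Finset.filter_erase]
  by_cases h1 : r j = ρ
  · refine (Finset.card_le_card (Finset.erase_subset _ _)).trans ?_
    rw [Finset.card_erase_of_mem (by simp [hj, h1])]
    have := hcl ρ
    omega
  by_cases h2 : r j' = ρ
  · rw [Finset.card_erase_of_mem (by simp [hj'.1, h2]; exact fun h => hj'.2 (by rw [h])),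
      Finset.erase_eq_of_notMem (by simp [h1])]
    have := hcl ρ
    omega
  refine (Finset.card_le_card ((Finset.erase_subset _ _).trans (Finset.erase_subset _ _))).trans ?_
  rcases (Q.filter fun x => r x = ρ).eq_empty_or_nonempty with h0 | ⟨x, hx⟩
  · simp [h0]
  rw [Finset.mem_filter] at hx
  obtain ⟨hx, rfl⟩ := hx
  have a1 := hmax' x (Finset.mem_filter.2 ⟨hx, fun h => h1 h.symm⟩)
  have a2 := hmax j' hj'.1
  have a3 : (Q.filter fun y => r y = r x).card + (Q.filter fun y => r y = r j').card ≤
      (Q.filter fun x => ¬ r x = r j).card := by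
    rw [← Finset.card_union_of_disjoint]
    · refine Finset.card_le_card fun y => ?_
      simp only [Finset.mem_union, Finset.mem_filter]
      rintro (⟨h, e⟩ | ⟨h, e⟩)
      · exact ⟨h, fun e' => h1 (e'.symm.trans e)⟩
      · exact ⟨h, fun e' => hj'.2 (e.symm.trans e')⟩
    · rw [Finset.disjoint_left]
      intro y hy hy'
      rw [Finset.mem_filter] at hy hy'
      exact h2 (hy'.2.symm.trans hy.2)
  omega

lemma pow_mul_mem_mixedSpan_union {U : Finset ι} {i : ℕ} {F : k[X][X]}
    (l : ℕ) (Q : Finset ι) (hF : F ∈ mixedSpan r U i) (hUQ : Disjoint U Q)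
    (hQ : Q.card = 2 * l) (hcl : ∀ ρ, (Q.filter fun j => r j = ρ).card ≤ l) :
    (X - C X) ^ l * F ∈ mixedSpan r (U ∪ Q) (i + l) := by
  induction l generalizing Q with
  | zero =>
    obtain rfl : Q = ∅ := by simpa using hQ
    simpa using hF
  | succ l ih =>
    obtain ⟨j, hj, j', hj', hr, hcl'⟩ := exists_pair_card_filter_erase_le r hQ hcl
    have hne : j' ≠ j := fun h => hr (congrArg r h.symm)
    have hmem : j' ∈ Q.erase j := Finset.mem_erase.2 ⟨hne, hj'⟩
    have h := ih ((Q.erase j).erase j')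
      (hUQ.mono_right ((Finset.erase_subset _ _).trans (Finset.erase_subset _ _)))
      (by rw [Finset.card_erase_of_mem hmem, Finset.card_erase_of_mem hj]; omega) hcl'
    have hjU : j ∉ U := Finset.disjoint_right.1 hUQ hj
    have hjU' : j' ∉ U := Finset.disjoint_right.1 hUQ hj'
    have h' := mul_mem_mixedSpan_insert_insert r (j := j) (j' := j')
      (by simp [hjU]) (by simp [hjU']) hr h
    have e : insert j (insert j' (U ∪ (Q.erase j).erase j')) = U ∪ Q := by
      rw [← Finset.union_insert, ← Finset.union_insert, Finset.insert_erase hmem,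
        Finset.insert_erase hj]
    rw [e] at h'
    rwa [pow_succ', mul_assoc, ← add_assoc]

lemma degreeLT_le_span_prod (d : ℕ) (T : Finset ι)
    (hT : ∀ ρ, (T.filter fun j => r j = ρ).card + d ≤ T.card) :
    degreeLT k (d + 1) ≤
      Submodule.span k {p | ∃ R ⊆ T, R.card = d ∧ p = ∏ j ∈ R, (X - C (r j))} := by
  induction d generalizing T with
  | zero =>
    intro p hp
    rw [mem_degreeLT] at hp
    have hp' : p = C (p.coeff 0) := by
      refine eq_C_of_degree_le_zero ?_
      exact Nat.WithBot.lt_one_iff_le_zero.1 (by simpa using hp)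
    rw [hp', ← mul_one (C _), ← smul_eq_C_mul]
    exact Submodule.smul_mem _ _ (Submodule.subset_span ⟨∅, by simp, by simp, by simp⟩)
  | succ d ih =>
    have key : ∀ e ∈ T, ∀ q : k[X], q.degree < (d + 1 : ℕ) → (X - C (r e)) * q ∈
        Submodule.span k {p | ∃ R ⊆ T, R.card = d + 1 ∧ p = ∏ j ∈ R, (X - C (r j))} := by
      intro e he q hq
      have hq' := ih (T.erase e) (fun ρ => by
        have h1 := hT ρ
        have h2 := Finset.card_le_card (Finset.filter_subset_filter (fun j => r j = ρ)
          (Finset.erase_subset e T))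
        rw [Finset.card_erase_of_mem he]
        omega) (mem_degreeLT.2 hq)
      suffices h : Submodule.span k {p | ∃ R ⊆ T.erase e, R.card = d ∧
          p = ∏ j ∈ R, (X - C (r j))} ≤ (Submodule.span k {p | ∃ R ⊆ T, R.card = d + 1 ∧
          p = ∏ j ∈ R, (X - C (r j))}).comap (LinearMap.mulLeft k (X - C (r e))) from h hq'
      refine Submodule.span_le.2 ?_
      rintro _ ⟨R, hR, rfl, rfl⟩
      have heR : e ∉ R := fun h => (Finset.mem_erase.1 (hR h)).1 rfl
      refine Submodule.subset_span ⟨insert e R, Finset.insert_subset he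
        (hR.trans (Finset.erase_subset _ _)), Finset.card_insert_of_notMem heR, ?_⟩
      rw [Finset.prod_insert heR]
      rfl
    intro p hp
    have hTc : 0 < T.card := by have := hT 0; omega
    obtain ⟨e, he⟩ := Finset.card_pos.1 hTc
    obtain ⟨f, hf, hef⟩ : ∃ f ∈ T, r f ≠ r e := by
      by_contra! h
      have h1 := hT (r e)
      rw [Finset.filter_true_of_mem h] at h1
      omega
    have hdecomp : p = (X - C (r e)) * (p /ₘ (X - C (r e)) +
        C ((r f - r e)⁻¹ * p.eval (r e))) -
        (X - C (r f)) * C ((r f - r e)⁻¹ * p.eval (r e)) := by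
      have h1 := modByMonic_add_div p (X - C (r e))
      rw [modByMonic_X_sub_C_eq_C_eval] at h1
      have h2 : C (r f - r e) * C ((r f - r e)⁻¹ * p.eval (r e)) = C (p.eval (r e)) := by
        rw [← C_mul, mul_inv_cancel_left₀ (sub_ne_zero.2 hef)]
      rw [C_sub] at h2
      linear_combination -h1 - h2
    have hc : ∀ c : k, (C c).degree < (d + 1 : ℕ) := fun c =>
      degree_C_le.trans_lt (by exact_mod_cast Nat.succ_pos d)
    rw [hdecomp]
    refine Submodule.sub_mem _ (key e he _ ?_) (key f hf _ (hc _))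
    refine (degree_add_le _ _).trans_lt (max_lt ?_ (hc _))
    rw [mem_degreeLT] at hp
    rcases eq_or_ne (p /ₘ (X - C (r e))) 0 with h0 | h0
    · rw [h0, degree_zero]; exact WithBot.bot_lt_coe _
    have hp0 : p ≠ 0 := by rintro rfl; simp at h0
    rw [← natDegree_lt_iff_degree_lt h0, natDegree_divByMonic _ (monic_X_sub_C _),
      natDegree_X_sub_C]
    rw [← natDegree_lt_iff_degree_lt hp0] at hp
    omega

lemma coeff_coeff_swap (F : k[X][X]) (m n : ℕ) :
    ((Bivariate.swap F).coeff m).coeff n = (F.coeff n).coeff m := by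
  induction F using Polynomial.induction_on' with
  | add p q hp hq => simp only [map_add, coeff_add, hp, hq]
  | monomial a p =>
    induction p using Polynomial.induction_on' with
    | add p q hp hq => simp only [map_add, coeff_add, hp, hq]
    | monomial b c =>
      rw [Bivariate.swap_monomial_monomial]
      simp only [coeff_monomial]
      split_ifs <;> simp [coeff_monomial, *]

omit [DecidableEq ι] in
lemma swap_mixedProd (S T : Finset ι) :
    Bivariate.swap (mixedProd r S T) = mixedProd r T S := by
  unfold mixedProd
  simp only [map_mul, map_prod, map_sub, Bivariate.swap_X, Bivariate.swap_Y,
    Bivariate.swap_C_C]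
  ring

lemma swap_mem_mixedSpan {U : Finset ι} {i : ℕ} {F : k[X][X]} (hF : F ∈ mixedSpan r U i) :
    Bivariate.swap F ∈ mixedSpan r U (U.card - i) := by
  suffices h : mixedSpan r U i ≤
      (mixedSpan r U (U.card - i)).comap (Bivariate.swap (R := k)).toLinearMap from h hF
  refine Submodule.span_le.2 ?_
  rintro _ ⟨S, hS, rfl, rfl⟩
  rw [SetLike.mem_coe, Submodule.mem_comap, AlgEquiv.toLinearMap_apply, swap_mixedProd]
  have := mixedProd_mem r (Finset.sdiff_subset (s := U) (t := S))
  rwa [Finset.sdiff_sdiff_eq_self hS, Finset.card_sdiff_of_subset hS] at this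

lemma natDegree_le_of_mem_mixedSpan {U : Finset ι} {i : ℕ} {F : k[X][X]}
    (hF : F ∈ mixedSpan r U i) : F.natDegree ≤ i := by
  suffices h : mixedSpan r U i ≤ (degreeLE k[X] i).restrictScalars k from
    natDegree_le_of_degree_le (mem_degreeLE.1 (h hF))
  refine Submodule.span_le.2 ?_
  rintro _ ⟨S, hS, rfl, rfl⟩
  refine mem_degreeLE.2 (degree_le_of_natDegree_le ?_)
  refine (natDegree_mul_C_le _ _).trans ((natDegree_prod_le _ _).trans ?_)
  simp

lemma natDegree_eval_X_le (G : k[X][X]) :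
    (G.eval X).natDegree ≤ G.natDegree + (Bivariate.swap G).natDegree := by
  rw [eval_eq_sum_range]
  refine natDegree_sum_le_of_forall_le _ _ fun p hp => ?_
  have h1 : (G.coeff p).natDegree ≤ (Bivariate.swap G).natDegree := by
    rw [natDegree_le_iff_coeff_eq_zero]
    intro N hN
    rw [← coeff_coeff_swap, coeff_eq_zero_of_natDegree_lt hN, coeff_zero]
  have h2 := natDegree_mul_le (p := G.coeff p) (q := (X : k[X]) ^ p)
  rw [natDegree_X_pow] at h2
  have := Finset.mem_range.1 hp
  omega

lemma natDegree_bounds_of_pow_mul_mem {U : Finset ι} {i l : ℕ} {G : k[X][X]} (hG : G ≠ 0)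
    (hF : (X - C X) ^ l * G ∈ mixedSpan r U i) :
    l + G.natDegree ≤ i ∧ l + (Bivariate.swap G).natDegree ≤ U.card - i := by
  have hm : ((X - C X : k[X][X]) ^ l).Monic := (monic_X_sub_C _).pow l
  constructor
  · have := natDegree_le_of_mem_mixedSpan r hF
    rwa [hm.natDegree_mul' hG, natDegree_pow, natDegree_X_sub_C, mul_one] at this
  · have := natDegree_le_of_mem_mixedSpan r (swap_mem_mixedSpan r hF)
    have e : Bivariate.swap ((X - C X) ^ l * G) = (-1) ^ l * ((X - C X) ^ l * Bivariate.swap G) := by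
      rw [map_mul, map_pow, map_sub, Bivariate.swap_X, Bivariate.swap_Y, ← mul_assoc, ← mul_pow]
      ring
    have hG' : Bivariate.swap G ≠ 0 := by simpa using hG
    have e1 : ((-1 : k[X][X]) ^ l * ((X - C X) ^ l * Bivariate.swap G)).natDegree =
        ((X - C X) ^ l * Bivariate.swap G).natDegree := by
      rcases neg_one_pow_eq_or k[X][X] l with h | h <;> simp [h]
    rwa [e, e1, hm.natDegree_mul' hG', natDegree_pow, natDegree_X_sub_C, mul_one] at this

/-- The coefficient of `(X - Y) ^ l` in the expansion of a polynomial in powers of `X - Y`. -/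
def diagCoeff (k : Type*) [Field k] (l : ℕ) : k[X][X] →ₗ[k] k[X] :=
  (lcoeff k[X] l ∘ₗ taylor X).restrictScalars k

lemma diagCoeff_apply (l : ℕ) (F : k[X][X]) : diagCoeff k l F = (taylor X F).coeff l := rfl

lemma diagCoeff_pow_mul (l : ℕ) (G : k[X][X]) : diagCoeff k l ((X - C X) ^ l * G) = G.eval X := by
  have h : taylor X (X - C X : k[X][X]) = X := by
    rw [map_sub, taylor_X, taylor_C]; ring
  rw [diagCoeff_apply, taylor_mul, taylor_pow, h, coeff_X_pow_mul', if_pos le_rfl, Nat.sub_self,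
    taylor_coeff_zero]

/-- The elements of `mixedSpan r U i` divisible by `(X - Y) ^ l`. -/
def mixedFilt (U : Finset ι) (i l : ℕ) : Submodule k k[X][X] :=
  mixedSpan r U i ⊓ (Ideal.span {(X - C X : k[X][X]) ^ l}).restrictScalars k

lemma mem_mixedFilt {U : Finset ι} {i l : ℕ} {F : k[X][X]} :
    F ∈ mixedFilt r U i l ↔ F ∈ mixedSpan r U i ∧ (X - C X) ^ l ∣ F := by
  rw [mixedFilt, Submodule.mem_inf, Submodule.restrictScalars_mem, Ideal.mem_span_singleton]

lemma mixedFilt_zero (U : Finset ι) (i : ℕ) : mixedFilt r U i 0 = mixedSpan r U i := by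
  ext F; simp [mem_mixedFilt]

instance (U : Finset ι) (i : ℕ) : FiniteDimensional k (mixedSpan r U i) := by
  refine FiniteDimensional.span_of_finite k
    ((U.powerset.finite_toSet.image fun S => mixedProd r S (U \ S)).subset ?_)
  rintro _ ⟨S, hS, -, rfl⟩
  exact ⟨S, by simpa using hS, rfl⟩

instance (U : Finset ι) (i l : ℕ) : FiniteDimensional k (mixedFilt r U i l) :=
  Submodule.finiteDimensional_of_le (S₂ := mixedSpan r U i) inf_le_left

lemma mixedFilt_eq_bot {U : Finset ι} {i l : ℕ} (hl : min i (U.card - i) < l) :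
    mixedFilt r U i l = ⊥ := by
  rw [eq_bot_iff]
  intro F hF
  obtain ⟨hF, G, rfl⟩ := (mem_mixedFilt r).1 hF
  by_contra h
  have hG : G ≠ 0 := by rintro rfl; simp at h
  have := natDegree_bounds_of_pow_mul_mem r hG hF
  omega

lemma ker_diagCoeff_inf_mixedFilt (U : Finset ι) (i l : ℕ) :
    LinearMap.ker (diagCoeff k l) ⊓ mixedFilt r U i l = mixedFilt r U i (l + 1) := by
  ext F
  rw [Submodule.mem_inf, mem_mixedFilt, mem_mixedFilt, LinearMap.mem_ker]
  constructor
  · rintro ⟨h0, hF, G, rfl⟩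
    refine ⟨hF, ?_⟩
    rw [diagCoeff_pow_mul] at h0
    rw [pow_succ]
    exact mul_dvd_mul_left _ (dvd_iff_isRoot.2 h0)
  · rintro ⟨hF, G, rfl⟩
    refine ⟨?_, hF, (pow_dvd_pow _ (Nat.le_succ l)).trans (dvd_mul_right _ _)⟩
    rw [pow_succ, mul_assoc, diagCoeff_pow_mul]
    simp

lemma finrank_eq_finrank_map_add_finrank_ker_inf {V W : Type*} [AddCommGroup V] [Module k V]
    [AddCommGroup W] [Module k W] (f : V →ₗ[k] W) (S : Submodule k V) [FiniteDimensional k S] :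
    Module.finrank k S = Module.finrank k (S.map f) +
      Module.finrank k (LinearMap.ker f ⊓ S : Submodule k V) := by
  have h := LinearMap.finrank_range_add_finrank_ker (f.domRestrict S)
  rw [LinearMap.range_domRestrict, LinearMap.ker_domRestrict,
    ← Submodule.finrank_map_subtype_eq S,
    Submodule.map_comap_subtype, inf_comm] at h
  exact h.symm

lemma finrank_mixedFilt_eq_add (U : Finset ι) (i l : ℕ) :
    Module.finrank k (mixedFilt r U i l) =
      Module.finrank k ((mixedFilt r U i l).map (diagCoeff k l)) +
        Module.finrank k (mixedFilt r U i (l + 1)) := by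
  rw [finrank_eq_finrank_map_add_finrank_ker_inf (diagCoeff k l), ker_diagCoeff_inf_mixedFilt]

/-- The predicate that the coefficient of `X ^ l` is divisible by `a ^ (p - l)` for all `l`. -/
def CoeffDvd {R : Type*} [CommRing R] (a : R) (p : ℕ) (F : R[X]) : Prop :=
  ∀ l, a ^ (p - l) ∣ F.coeff l

lemma CoeffDvd.mul {R : Type*} [CommRing R] {a : R} {p q : ℕ} {F G : R[X]}
    (hF : CoeffDvd a p F) (hG : CoeffDvd a q G) : CoeffDvd a (p + q) (F * G) := by
  intro l
  rw [coeff_mul]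
  refine Finset.dvd_sum fun x hx => ?_
  rw [Finset.HasAntidiagonal.mem_antidiagonal] at hx
  refine (pow_dvd_pow a ?_).trans ((pow_add a _ _).dvd.trans (mul_dvd_mul (hF x.1) (hG x.2)))
  omega

lemma CoeffDvd.prod {R : Type*} [CommRing R] {a : R} (s : Finset ι) (e : ι → ℕ) (F : ι → R[X])
    (h : ∀ j ∈ s, CoeffDvd a (e j) (F j)) : CoeffDvd a (∑ j ∈ s, e j) (∏ j ∈ s, F j) := by
  induction s using Finset.induction_on with
  | empty => intro l; simp
  | insert j s hj ih =>
    rw [Finset.sum_insert hj, Finset.prod_insert hj]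
    exact (h j (Finset.mem_insert_self _ _)).mul
      (ih fun x hx => h x (Finset.mem_insert_of_mem hx))

lemma coeffDvd_taylor_of_mem_mixedSpan {U : Finset ι} {i : ℕ} {F : k[X][X]}
    (hF : F ∈ mixedSpan r U i) (ρ : k) :
    CoeffDvd (X - C ρ) (U.filter fun j => r j = ρ).card (taylor X F) := by
  intro l
  change _ ∣ diagCoeff k l F
  suffices h : mixedSpan r U i ≤ ((Ideal.span {(X - C ρ) ^
      ((U.filter fun j => r j = ρ).card - l)}).restrictScalars k).comap (diagCoeff k l) from
    Ideal.mem_span_singleton.1 (h hF)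
  refine Submodule.span_le.2 ?_
  rintro _ ⟨S, hS, rfl, rfl⟩
  rw [SetLike.mem_coe, Submodule.mem_comap, Submodule.restrictScalars_mem,
    Ideal.mem_span_singleton, diagCoeff_apply]
  have hcard : (U.filter fun j => r j = ρ).card =
      ∑ j ∈ S, (if r j = ρ then 1 else 0) + ∑ j ∈ U \ S, (if r j = ρ then 1 else 0) := by
    rw [add_comm, Finset.sum_sdiff hS, Finset.card_filter]
  have ht : taylor X (mixedProd r S (U \ S)) =
      (∏ j ∈ S, (X + C (X - C (r j)))) * ∏ j ∈ U \ S, C (X - C (r j)) := by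
    unfold mixedProd
    rw [taylor_mul, taylor_C, taylor_apply, prod_comp, map_prod]
    congr 1
    refine Finset.prod_congr rfl fun j _ => ?_
    rw [sub_comp, X_comp, C_comp, C_sub]
    ring
  rw [ht, hcard]
  refine CoeffDvd.mul (CoeffDvd.prod _ _ _ fun j _ => ?_) (CoeffDvd.prod _ _ _ fun j _ => ?_) l
  all_goals
    intro m
    split_ifs with h
    · rcases m with _ | m <;> simp [h]
    · simp

/-- The sum over the values `ρ` of `r` on `U` of the multiplicity of `ρ` truncated at `l`. -/
def truncCard (U : Finset ι) (l : ℕ) : ℕ :=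
  ∑ ρ ∈ U.image r, min (U.filter fun j => r j = ρ).card l

/-- The product of the `(X - ρ) ^ (m - l)` over the values `ρ` of `r` on `U`, where `m` is the
multiplicity of `ρ`. -/
def excessProd (U : Finset ι) (l : ℕ) : k[X] :=
  ∏ ρ ∈ U.image r, (X - C ρ) ^ ((U.filter fun j => r j = ρ).card - l)

omit [DecidableEq ι] in
lemma monic_excessProd (U : Finset ι) (l : ℕ) : (excessProd r U l).Monic :=
  monic_prod_of_monic _ _ fun _ _ => (monic_X_sub_C _).pow _

omit [DecidableEq ι] in
lemma natDegree_excessProd_add_truncCard (U : Finset ι) (l : ℕ) :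
    (excessProd r U l).natDegree + truncCard r U l = U.card := by
  rw [excessProd, natDegree_prod_of_monic _ _ fun _ _ => (monic_X_sub_C _).pow _, truncCard,
    ← Finset.sum_add_distrib,
    Finset.card_eq_sum_card_fiberwise (f := r) (t := U.image r)
      fun j hj => Finset.mem_coe.2 (Finset.mem_image_of_mem r hj)]
  refine Finset.sum_congr rfl fun ρ _ => ?_
  rw [natDegree_pow, natDegree_X_sub_C]
  omega

lemma exists_truncation (U : Finset ι) (l : ℕ) : ∃ T ⊆ U, T.card = truncCard r U l ∧
    (∀ ρ, (T.filter fun j => r j = ρ).card ≤ l) ∧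
    ∏ j ∈ U \ T, (X - C (r j)) = excessProd r U l := by
  choose t ht htc using fun ρ => Finset.exists_subset_card_eq
    (min_le_left (U.filter fun j => r j = ρ).card l)
  have hfib : ∀ ρ, ((U.filter fun j => j ∈ t (r j)).filter fun j => r j = ρ) = t ρ := by
    intro ρ
    ext j
    rw [Finset.mem_filter, Finset.mem_filter]
    constructor
    · rintro ⟨⟨-, h⟩, rfl⟩; exact h
    · intro h
      have h' := Finset.mem_filter.1 (ht ρ h)
      exact ⟨⟨h'.1, by rwa [h'.2]⟩, h'.2⟩
  have hsub : (U.filter fun j => j ∈ t (r j)) ⊆ U := Finset.filter_subset _ _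
  refine ⟨_, hsub, ?_, fun ρ => ?_, ?_⟩
  · rw [Finset.card_eq_sum_card_fiberwise (f := r) (t := U.image r)
      fun j hj => Finset.mem_coe.2 (Finset.mem_image_of_mem r (hsub hj))]
    exact Finset.sum_congr rfl fun ρ _ => by rw [hfib, htc]
  · rw [hfib, htc]; exact min_le_right _ _
  · rw [← Finset.prod_fiberwise_of_maps_to (g := r) (t := U.image r)
      fun j hj => Finset.mem_image_of_mem r (Finset.sdiff_subset hj)]
    refine Finset.prod_congr rfl fun ρ _ => ?_
    rw [Finset.prod_congr rfl fun j hj => by rw [(Finset.mem_filter.1 hj).2],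
      Finset.prod_const]
    congr 1
    have e : ((U \ U.filter fun j => j ∈ t (r j)).filter fun j => r j = ρ) =
        (U.filter fun j => r j = ρ) \ t ρ := by
      ext j
      rw [← hfib ρ]
      simp only [Finset.mem_filter, Finset.mem_sdiff]
      tauto
    rw [e, Finset.card_sdiff_of_subset (ht ρ), htc]
    omega

lemma map_diagCoeff_mixedFilt_le {U : Finset ι} {i : ℕ} (hi : i ≤ U.card) (l : ℕ) :
    (mixedFilt r U i l).map (diagCoeff k l) ≤
      (degreeLT k (truncCard r U l + 1 - 2 * l)).map (LinearMap.mulLeft k (excessProd r U l)) := by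
  rintro _ ⟨F, hF, rfl⟩
  obtain ⟨hF, G, rfl⟩ := (mem_mixedFilt r).1 hF
  have hdvd : excessProd r U l ∣ diagCoeff k l ((X - C X) ^ l * G) := by
    refine Finset.prod_dvd_of_coprime (fun ρ _ ρ' _ h => ?_) fun ρ _ =>
      coeffDvd_taylor_of_mem_mixedSpan r hF ρ l
    exact (isCoprime_X_sub_C_of_isUnit_sub (sub_ne_zero.2 h).isUnit).pow
  obtain ⟨q, hq⟩ := hdvd
  refine ⟨q, mem_degreeLT.2 ?_, hq.symm⟩
  rcases eq_or_ne q 0 with rfl | hq0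
  · rw [degree_zero]; exact WithBot.bot_lt_coe _
  rw [diagCoeff_pow_mul] at hq
  have hG : G ≠ 0 := by
    rintro rfl
    rw [eval_zero] at hq
    exact mul_ne_zero (monic_excessProd r U l).ne_zero hq0 hq.symm
  have h1 := natDegree_eval_X_le G
  have h2 := natDegree_bounds_of_pow_mul_mem r hG hF
  have h3 := natDegree_excessProd_add_truncCard r U l
  rw [hq, (monic_excessProd r U l).natDegree_mul' hq0] at h1
  rw [← natDegree_lt_iff_degree_lt hq0]
  omega

lemma le_map_diagCoeff_mixedFilt {U : Finset ι} {i l : ℕ} (hl : l ≤ i) (hl' : l + i ≤ U.card) :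
    (degreeLT k (truncCard r U l + 1 - 2 * l)).map (LinearMap.mulLeft k (excessProd r U l)) ≤
      (mixedFilt r U i l).map (diagCoeff k l) := by
  rcases lt_or_ge (truncCard r U l) (2 * l) with h | h
  · rw [Nat.sub_eq_zero_of_le h]
    rintro _ ⟨q, hq, rfl⟩
    have : q = 0 := by
      have := mem_degreeLT.1 hq
      rwa [Nat.cast_zero, Nat.WithBot.lt_zero_iff, degree_eq_bot] at this
    rw [this, map_zero]
    exact zero_mem _
  obtain ⟨T, hTU, hTc, hTl, hTP⟩ := exists_truncation r U l
  obtain ⟨d, hd⟩ := Nat.exists_eq_add_of_le h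
  rw [show truncCard r U l + 1 - 2 * l = d + 1 by omega]
  refine (Submodule.map_mono (degreeLT_le_span_prod r d T fun ρ => ?_)).trans ?_
  · have := hTl ρ
    omega
  rw [Submodule.map_span_le]
  rintro _ ⟨R, hR, hRc, rfl⟩
  have hUc : (U \ (T \ R)).card = U.card - 2 * l := by
    rw [Finset.card_sdiff_of_subset (Finset.sdiff_subset.trans hTU),
      Finset.card_sdiff_of_subset hR]
    omega
  obtain ⟨S, hS, hSc⟩ := Finset.exists_subset_card_eq (s := U \ (T \ R)) (n := i - l) (by omega)
  have hmem := pow_mul_mem_mixedSpan_union r l (T \ R) (mixedProd_mem r hS)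
    Finset.sdiff_disjoint (by rw [Finset.card_sdiff_of_subset hR]; omega)
    fun ρ => (Finset.card_le_card (Finset.filter_subset_filter _ Finset.sdiff_subset)).trans (hTl ρ)
  rw [Finset.sdiff_union_of_subset (Finset.sdiff_subset.trans hTU), hSc, Nat.sub_add_cancel hl]
    at hmem
  refine ⟨_, (mem_mixedFilt r).2 ⟨hmem, dvd_mul_right _ _⟩, ?_⟩
  rw [diagCoeff_pow_mul, LinearMap.mulLeft_apply, ← hTP]
  have hdisj : Disjoint (U \ T) R := Finset.sdiff_disjoint.mono_right hR
  have hun : U \ (T \ R) = (U \ T) ∪ R := by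
    ext x
    have h1 := @hR x
    have h2 := @hTU x
    simp only [Finset.mem_sdiff, Finset.mem_union]
    tauto
  rw [← Finset.prod_union hdisj, ← hun, ← Finset.prod_sdiff hS, mul_comm]
  unfold mixedProd
  simp [eval_prod]

lemma finrank_map_diagCoeff_mixedFilt {U : Finset ι} {i l : ℕ} (hl : l ≤ i)
    (hl' : l + i ≤ U.card) :
    Module.finrank k ((mixedFilt r U i l).map (diagCoeff k l)) = truncCard r U l + 1 - 2 * l := by
  have : FiniteDimensional k (degreeLT k (truncCard r U l + 1 - 2 * l)) :=
    Module.Finite.equiv (degreeLTEquiv k _).symm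
  have hker : LinearMap.ker (LinearMap.mulLeft k (excessProd r U l)) = ⊥ :=
    LinearMap.ker_eq_bot.2 (mul_right_injective₀ (monic_excessProd r U l).ne_zero)
  have h := finrank_eq_finrank_map_add_finrank_ker_inf (LinearMap.mulLeft k (excessProd r U l))
    (degreeLT k (truncCard r U l + 1 - 2 * l))
  rw [hker, bot_inf_eq, finrank_bot, add_zero, (degreeLTEquiv k _).finrank_eq,
    Module.finrank_fin_fun] at h
  rw [le_antisymm (map_diagCoeff_mixedFilt_le r (by omega) l)
    (le_map_diagCoeff_mixedFilt r hl hl'), ← h]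

lemma finrank_mixedSpan {U : Finset ι} {i : ℕ} (hi : i ≤ U.card) :
    Module.finrank k (mixedSpan r U i) =
      ∑ l ∈ Finset.range (min i (U.card - i) + 1), (truncCard r U l + 1 - 2 * l) := by
  have key : ∀ m ≤ min i (U.card - i) + 1, Module.finrank k (mixedSpan r U i) =
      ∑ l ∈ Finset.range m, (truncCard r U l + 1 - 2 * l) +
        Module.finrank k (mixedFilt r U i m) := by
    intro m hm
    induction m with
    | zero => rw [mixedFilt_zero]; simp
    | succ m ih =>
      rw [ih (by omega), Finset.sum_range_succ, finrank_mixedFilt_eq_add,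
        finrank_map_diagCoeff_mixedFilt r (by omega) (by omega), add_assoc]
  rw [key _ le_rfl, mixedFilt_eq_bot r (Nat.lt_succ_self _), finrank_bot, add_zero]

end Mixed

section LinearAlgebra

variable {k : Type*} [Field k]

lemma mem_of_forall_sum_pow_smul_mem [Infinite k] {V : Type*} [AddCommGroup V] [Module k V]
    (A : Submodule k V) (y : ℕ → V) (N : ℕ)
    (h : ∀ t : k, t ≠ 0 → ∑ i ∈ Finset.range N, t ^ i • y i ∈ A) {i : ℕ} (hi : i < N) :
    y i ∈ A := by
  rw [← Submodule.Quotient.mk_eq_zero, ← Module.forall_dual_apply_eq_zero_iff k]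
  intro φ
  set p : k[X] := ∑ i ∈ Finset.range N, monomial i (φ (Submodule.Quotient.mk (y i))) with hp
  have hp0 : p = 0 := by
    refine eq_zero_of_infinite_isRoot p ((Set.finite_singleton (0 : k)).infinite_compl.mono ?_)
    intro t ht
    have h1 := (Submodule.Quotient.mk_eq_zero A).2 (h t ht)
    have h2 := congrArg φ h1
    rw [← Submodule.mkQ_apply, map_sum, map_sum, map_zero] at h2
    rw [Set.mem_ofPred_eq, IsRoot, hp, eval_finsetSum, ← h2]
    refine Finset.sum_congr rfl fun i _ => ?_
    rw [eval_monomial, map_smul, map_smul, smul_eq_mul, mul_comm, Submodule.mkQ_apply]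
  have h3 := congrArg (fun q => coeff q i) hp0
  simpa [hp, finsetSum_coeff, coeff_monomial, hi] using h3

lemma trace_restrict_eq_finrank {V : Type*} [AddCommGroup V] [Module k V] (A : Submodule k V)
    [FiniteDimensional k A] (P : V →ₗ[k] V) (hP : IsIdempotentElem P) (hA : ∀ x ∈ A, P x ∈ A) :
    LinearMap.trace k A (P.restrict hA) = (Module.finrank k (A.map P) : k) := by
  have hid : IsIdempotentElem (P.restrict hA) :=
    LinearMap.ext fun x => Subtype.ext (LinearMap.congr_fun hP (x : V))
  have hmap : (LinearMap.range (P.restrict hA)).map A.subtype = A.map P := by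
    rw [LinearMap.range_eq_map, ← Submodule.map_comp]
    have : A.subtype ∘ₗ P.restrict hA = P ∘ₗ A.subtype := rfl
    rw [this, Submodule.map_comp, Submodule.map_subtype_top]
  rw [(LinearMap.IsIdempotentElem.isProj_range _ hid).trace, ← hmap, Submodule.finrank_map_subtype_eq]

lemma finrank_span_range_add_finrank_ker {E F : Type*} [AddCommGroup E] [Module k E] [Fintype F]
    (p : F → E) : Module.finrank k (Submodule.span k (Set.range p)) +
      Module.finrank k (LinearMap.ker (Fintype.linearCombination k p)) = Fintype.card F := by
  rw [← Fintype.range_linearCombination, LinearMap.finrank_range_add_finrank_ker,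
    Module.finrank_fintype_fun_eq_card]

lemma finrank_span_range_eq_of_forall_sum_eq_zero_iff {E F G : Type*} [AddCommGroup E]
    [Module k E] [Fintype F] [DecidableEq F] (u : G → F → k) (p : F → E)
    (h : ∀ c : F → k, (∀ g, ∑ f, c f * u g f = 0) ↔ ∑ f, c f • p f = 0) :
    Module.finrank k (Submodule.span k (Set.range u)) =
      Module.finrank k (Submodule.span k (Set.range p)) := by
  have h1 := finrank_span_range_add_finrank_ker (k := k) p
  have h2 := Subspace.finrank_add_finrank_dualAnnihilator_eq (Submodule.span k (Set.range u))
  rw [Module.finrank_fintype_fun_eq_card] at h2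
  have h3 : (LinearMap.ker (Fintype.linearCombination k p)).map
      (dotProductEquiv k F).toLinearMap = (Submodule.span k (Set.range u)).dualAnnihilator := by
    ext φ
    obtain ⟨c, rfl⟩ := (dotProductEquiv k F).surjective φ
    rw [← LinearEquiv.coe_coe, Submodule.mem_map_equiv, LinearEquiv.coe_coe,
      LinearEquiv.symm_apply_apply, LinearMap.mem_ker, Fintype.linearCombination_apply, ← h,
      Submodule.mem_dualAnnihilator]
    constructor
    · intro hc w hw
      have : Submodule.span k (Set.range u) ≤ LinearMap.ker (dotProductEquiv k F c) := by
        refine Submodule.span_le.2 ?_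
        rintro _ ⟨g, rfl⟩
        exact hc g
      exact this hw
    · exact fun hc g => hc (u g) (Submodule.subset_span ⟨g, rfl⟩)
  rw [← h3, LinearEquiv.finrank_map_eq] at h2
  omega

end LinearAlgebra

section Configuration

variable {k : Type*} [Field k] {n : ℕ}

/-- The coordinates on `(k²)^{⊗n}` in the standard basis. -/
def tensorCoord (k : Type*) [Field k] (n : ℕ) :
    (PiTensorProduct k fun _ : Fin n => Fin 2 → k) ≃ₗ[k] ((Fin n → Fin 2) → k) :=
  (Basis.piTensorProduct fun _ : Fin n => Pi.basisFun k (Fin 2)).equivFun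

lemma tensorCoord_tprod (w : Fin n → Fin 2 → k) (f : Fin n → Fin 2) :
    tensorCoord k n (PiTensorProduct.tprod k w) f = ∏ j, w j (f j) := by
  simp [tensorCoord]

/-- The positions at which `f` takes the value `0`. -/
def zeroSet (f : Fin n → Fin 2) : Finset (Fin n) := Finset.univ.filter fun j => f j = 0

/-- The projection of `(k²)^{⊗n}` onto the weight space of `diag(a,b)` with weight
`a ^ i * b ^ (n - i)`. -/
def weightProj (k : Type*) [Field k] (n i : ℕ) :
    (PiTensorProduct k fun _ : Fin n => Fin 2 → k) →ₗ[k]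
      (PiTensorProduct k fun _ : Fin n => Fin 2 → k) :=
  (tensorCoord k n).symm.toLinearMap ∘ₗ
    (LinearMap.pi fun f => if (zeroSet f).card = i then LinearMap.proj f else 0) ∘ₗ
    (tensorCoord k n).toLinearMap

lemma tensorCoord_weightProj (i : ℕ) (x : PiTensorProduct k fun _ : Fin n => Fin 2 → k)
    (f : Fin n → Fin 2) : tensorCoord k n (weightProj k n i x) f =
      if (zeroSet f).card = i then tensorCoord k n x f else 0 := by
  simp only [weightProj, LinearMap.comp_apply, LinearEquiv.coe_coe, LinearEquiv.apply_symm_apply,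
    LinearMap.pi_apply]
  split_ifs <;> simp

lemma isIdempotentElem_weightProj (i : ℕ) : IsIdempotentElem (weightProj k n i) := by
  refine LinearMap.ext fun x => (tensorCoord k n).injective (funext fun f => ?_)
  rw [Module.End.mul_apply, tensorCoord_weightProj, tensorCoord_weightProj]
  split_ifs <;> rfl

lemma card_zeroSet_le (f : Fin n → Fin 2) : (zeroSet f).card ≤ n :=
  (Finset.card_le_univ _).trans_eq (Fintype.card_fin n)

lemma weightProj_eq_zero {i : ℕ} (hi : n < i) : weightProj k n i = 0 := by
  refine LinearMap.ext fun x => (tensorCoord k n).injective (funext fun f => ?_)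
  rw [tensorCoord_weightProj, if_neg (by have := card_zeroSet_le f; omega)]
  simp

lemma prod_eq_prod_zeroSet_mul {M : Type*} [CommMonoid M] (f : Fin n → Fin 2)
    (h : Fin n → Fin 2 → M) : ∏ j, h j (f j) =
      (∏ j ∈ zeroSet f, h j 0) * ∏ j ∈ Finset.univ \ zeroSet f, h j 1 := by
  rw [← Finset.prod_sdiff (Finset.subset_univ (zeroSet f)), mul_comm]
  congr 1
  · exact Finset.prod_congr rfl fun j hj => by rw [(Finset.mem_filter.1 hj).2]
  · refine Finset.prod_congr rfl fun j hj => ?_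
    have : f j ≠ 0 := by simpa [zeroSet] using hj
    rw [show f j = 1 by omega]

lemma diagAct_diagonal_apply (a b : k) (x : PiTensorProduct k fun _ : Fin n => Fin 2 → k) :
    diagAct k (Matrix.diagonal ![a, b]) x =
      ∑ i ∈ Finset.range (n + 1), (a ^ i * b ^ (n - i)) • weightProj k n i x := by
  refine (tensorCoord k n).injective (funext fun f => ?_)
  rw [map_sum, Finset.sum_apply, Finset.sum_eq_single_of_mem (zeroSet f).card
    (Finset.mem_range.2 (Nat.lt_succ_of_le (card_zeroSet_le f)))]
  · rw [map_smul, Pi.smul_apply, tensorCoord_weightProj, if_pos rfl]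
    induction x using PiTensorProduct.induction_on with
    | smul_tprod c w =>
      rw [map_smul, map_smul, map_smul, diagAct, PiTensorProduct.map_tprod, Pi.smul_apply,
        Pi.smul_apply, tensorCoord_tprod, tensorCoord_tprod, smul_comm]
      congr 1
      have : ∀ j, (Matrix.diagonal ![a, b]).mulVecLin (w j) (f j) = ![a, b] (f j) * w j (f j) :=
        fun j => by rw [Matrix.mulVecLin_apply, Matrix.mulVec_diagonal]
      rw [Finset.prod_congr rfl fun j _ => this j, Finset.prod_mul_distrib, smul_eq_mul]
      congr 1
      rw [prod_eq_prod_zeroSet_mul f fun _ e => ![a, b] e, Finset.prod_const, Finset.prod_const,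
        Finset.card_sdiff_of_subset (Finset.subset_univ _), Finset.card_univ, Fintype.card_fin]
      rfl
    | add x y hx hy => rw [map_add, map_add, map_add, Pi.add_apply, Pi.add_apply, hx, hy, smul_add]
  · intro i _ hi
    rw [map_smul, Pi.smul_apply, tensorCoord_weightProj, if_neg hi.symm, smul_zero]

lemma diagAct_mem_tensMod (v : Matrix (Fin 2) (Fin n) k) (g : (Matrix (Fin 2) (Fin 2) k)ˣ)
    {x : PiTensorProduct k fun _ : Fin n => Fin 2 → k} (hx : x ∈ tensMod k v) :
    diagAct k g.1 x ∈ tensMod k v := by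
  suffices h : tensMod k v ≤ (tensMod k v).comap (diagAct k g.1) from h hx
  refine Submodule.span_le.2 ?_
  rintro _ ⟨h, rfl⟩
  refine Submodule.subset_span ⟨g * h, ?_⟩
  rw [vtens, diagAct, diagAct, diagAct, PiTensorProduct.map_tprod, PiTensorProduct.map_tprod,
    PiTensorProduct.map_tprod, Units.val_mul]
  simp

lemma diagAct_diagonal_mem_tensMod (v : Matrix (Fin 2) (Fin n) k) {a b : k} (ha : a ≠ 0)
    (hb : b ≠ 0) {x : PiTensorProduct k fun _ : Fin n => Fin 2 → k} (hx : x ∈ tensMod k v) :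
    diagAct k (Matrix.diagonal ![a, b]) x ∈ tensMod k v := by
  have hu : IsUnit (Matrix.diagonal ![a, b]) := by
    rw [Matrix.isUnit_iff_isUnit_det, Matrix.det_diagonal]
    simp [ha, hb]
  obtain ⟨g, hg⟩ := hu
  rw [← hg]
  exact diagAct_mem_tensMod v g hx

lemma weightProj_mem_tensMod [Infinite k] (v : Matrix (Fin 2) (Fin n) k) (i : ℕ)
    {x : PiTensorProduct k fun _ : Fin n => Fin 2 → k} (hx : x ∈ tensMod k v) :
    weightProj k n i x ∈ tensMod k v := by
  rcases lt_or_ge n i with hi | hi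
  · rw [weightProj_eq_zero hi]
    exact zero_mem _
  refine mem_of_forall_sum_pow_smul_mem (tensMod k v) (fun i => weightProj k n i x) (n + 1)
    (fun t ht => ?_) (Nat.lt_succ_of_le hi)
  have := diagAct_diagonal_mem_tensMod v ht one_ne_zero hx
  simpa [diagAct_diagonal_apply] using this

instance : FiniteDimensional k (PiTensorProduct k fun _ : Fin n => Fin 2 → k) :=
  Module.Finite.equiv (tensorCoord k n).symm

lemma trace_diagAct_restrict [Infinite k] (v : Matrix (Fin 2) (Fin n) k) (a b : k)
    (hpres : ∀ x ∈ tensMod k v, diagAct k (Matrix.diagonal ![a, b]) x ∈ tensMod k v) :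
    LinearMap.trace k (tensMod k v) ((diagAct k (Matrix.diagonal ![a, b])).restrict hpres) =
      ∑ i ∈ Finset.range (n + 1), a ^ i * b ^ (n - i) *
        (Module.finrank k ((tensMod k v).map (weightProj k n i)) : k) := by
  have h : (diagAct k (Matrix.diagonal ![a, b])).restrict hpres =
      ∑ i ∈ Finset.range (n + 1), (a ^ i * b ^ (n - i)) •
        (weightProj k n i).restrict fun _ hx => weightProj_mem_tensMod v i hx := by
    refine LinearMap.ext fun x => Subtype.ext ?_
    rw [LinearMap.coe_restrict_apply, diagAct_diagonal_apply]
    simp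
  rw [h, map_sum]
  refine Finset.sum_congr rfl fun i _ => ?_
  rw [map_smul, smul_eq_mul,
    trace_restrict_eq_finrank _ _ (isIdempotentElem_weightProj i)]

lemma finrank_map_weightProj_tensMod (v : Matrix (Fin 2) (Fin n) k) (i : ℕ) :
    Module.finrank k ((tensMod k v).map (weightProj k n i)) =
      Module.finrank k (Submodule.span k (Set.range
        fun (g : (Matrix (Fin 2) (Fin 2) k)ˣ) (f : Fin n → Fin 2) =>
          if (zeroSet f).card = i then ∏ j, (g.1 * v) (f j) j else 0)) := by
  rw [← (tensorCoord k n).finrank_map_eq, tensMod, Submodule.map_span, Submodule.map_span]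
  have h : (tensorCoord k n).toLinearMap '' (weightProj k n i '' {x | ∃ g :
      (Matrix (Fin 2) (Fin 2) k)ˣ, x = diagAct k g.1 (vtens k v)}) = Set.range
        fun (g : (Matrix (Fin 2) (Fin 2) k)ˣ) (f : Fin n → Fin 2) =>
          if (zeroSet f).card = i then ∏ j, (g.1 * v) (f j) j else 0 := by
    have hg : ∀ g : (Matrix (Fin 2) (Fin 2) k)ˣ,
        tensorCoord k n (weightProj k n i (diagAct k g.1 (vtens k v))) = fun f =>
          if (zeroSet f).card = i then ∏ j, (g.1 * v) (f j) j else 0 := by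
      intro g
      funext f
      rw [tensorCoord_weightProj, diagAct, vtens, PiTensorProduct.map_tprod, tensorCoord_tprod]
      rfl
    ext y
    constructor
    · rintro ⟨_, ⟨_, ⟨g, rfl⟩, rfl⟩, rfl⟩
      exact ⟨g, (hg g).symm⟩
    · rintro ⟨g, rfl⟩
      exact ⟨_, ⟨_, ⟨g, rfl⟩, rfl⟩, hg g⟩
  rw [h]

end Configuration

section Comparison

variable {k : Type*} [Field k] {n : ℕ}

lemma evalEval_mixedProd {ι : Type*} (r : ι → k) (S T : Finset ι) (x y : k) :
    evalEval y x (mixedProd r S T) = (∏ j ∈ S, (x - r j)) * ∏ j ∈ T, (y - r j) := by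
  simp [mixedProd, evalEval, eval_prod]

lemma eq_zero_of_forall_ne_evalEval_eq_zero [Infinite k] {F : k[X][X]}
    (h : ∀ x y : k, x ≠ y → evalEval y x F = 0) : F = 0 := by
  refine Polynomial.eq_zero_of_infinite_isRoot F
    ((Set.infinite_range_of_injective (C_injective (R := k))).mono ?_)
  rintro _ ⟨x, rfl⟩
  refine Polynomial.eq_zero_of_infinite_isRoot _
    ((Set.finite_singleton x).infinite_compl.mono fun y hy => ?_)
  exact h x y fun hxy => hy hxy.symm

/-- The mixed product attached to `f` if `f` takes the value `0` exactly `i` times, and `0`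
otherwise. -/
def weightProd (r : Fin n → k) (i : ℕ) (f : Fin n → Fin 2) : k[X][X] :=
  if (zeroSet f).card = i then mixedProd r (zeroSet f) (Finset.univ \ zeroSet f) else 0

lemma mixedSpan_eq_span_range_weightProd (r : Fin n → k) (i : ℕ) :
    mixedSpan r Finset.univ i = Submodule.span k (Set.range (weightProd r i)) := by
  refine le_antisymm (Submodule.span_le.2 ?_) (Submodule.span_le.2 ?_)
  · rintro _ ⟨S, -, hS, rfl⟩
    have hz : zeroSet (fun j => if j ∈ S then (0 : Fin 2) else 1) = S := by
      ext j
      simp [zeroSet]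
    refine Submodule.subset_span ⟨fun j => if j ∈ S then 0 else 1, ?_⟩
    rw [weightProd, hz, if_pos hS]
  · rintro _ ⟨f, rfl⟩
    rw [weightProd]
    split_ifs with hf
    · exact Submodule.subset_span ⟨zeroSet f, Finset.subset_univ _, hf, rfl⟩
    · exact zero_mem _

lemma sum_weight_eq_evalEval (r : Fin n → k) (i : ℕ) (c : (Fin n → Fin 2) → k)
    (α β : Fin 2 → k) (hβ : ∀ e, β e ≠ 0) :
    ∑ f, c f * (if (zeroSet f).card = i then ∏ j, (α (f j) - r j * β (f j)) else 0) =
      β 0 ^ i * β 1 ^ (n - i) *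
        evalEval (α 1 / β 1) (α 0 / β 0) (∑ f, c f • weightProd r i f) := by
  rw [← coe_evalEvalRingHom, map_sum, Finset.mul_sum]
  refine Finset.sum_congr rfl fun f _ => ?_
  rw [coe_evalEvalRingHom, evalEval_smul, weightProd, smul_eq_mul, mul_left_comm]
  split_ifs with hf
  · have hdiv : ∀ e x, α e - x * β e = β e * (α e / β e - x) := fun e x => by
      field_simp [hβ e]
    rw [evalEval_mixedProd, prod_eq_prod_zeroSet_mul f fun j e => α e - r j * β e]
    simp only [hdiv]
    rw [Finset.prod_mul_distrib, Finset.prod_mul_distrib, Finset.prod_const, Finset.prod_const,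
      Finset.card_sdiff_of_subset (Finset.subset_univ _), Finset.card_univ, Fintype.card_fin, hf]
    ring
  · simp

lemma sum_weight_eq_zero [Infinite k] (r : Fin n → k) (i : ℕ) (c : (Fin n → Fin 2) → k)
    (hc : ∑ f, c f • weightProd r i f = 0) (α β : Fin 2 → k) :
    ∑ f, c f * (if (zeroSet f).card = i then ∏ j, (α (f j) - r j * β (f j)) else 0) = 0 := by
  set q : k[X] := ∑ f, C (c f) * (if (zeroSet f).card = i then
    ∏ j, (C (α (f j)) - C (r j) * (X + C (β (f j)))) else 0) with hq
  have heval : ∀ s, q.eval s = ∑ f, c f * (if (zeroSet f).card = i then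
      ∏ j, (α (f j) - r j * (s + β (f j))) else 0) := by
    intro s
    rw [hq, eval_finsetSum]
    refine Finset.sum_congr rfl fun f _ => ?_
    split_ifs <;> simp [eval_prod]
  have hq0 : q = 0 := by
    refine Polynomial.eq_zero_of_infinite_isRoot q
      ((Set.finite_range fun e => -β e).infinite_compl.mono fun s hs => ?_)
    have h := sum_weight_eq_evalEval r i c α (fun e => s + β e)
      fun e he => hs ⟨e, (eq_neg_of_add_eq_zero_left he).symm⟩
    rw [hc] at h
    rw [Set.mem_ofPred_eq, IsRoot, heval, h]
    simp
  have h0 := heval 0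
  rw [hq0] at h0
  simpa using h0.symm

lemma finrank_weightSpan_eq_finrank_mixedSpan [Infinite k] (v : Matrix (Fin 2) (Fin n) k)
    (d r : Fin n → k) (t : k) (hd : ∀ j, d j ≠ 0) (h0 : ∀ j, v 0 j = -(d j * r j))
    (h1 : ∀ j, v 1 j = d j * (1 + t * r j)) (i : ℕ) :
    Module.finrank k (Submodule.span k (Set.range
        fun (g : (Matrix (Fin 2) (Fin 2) k)ˣ) (f : Fin n → Fin 2) =>
          if (zeroSet f).card = i then ∏ j, (g.1 * v) (f j) j else 0)) =
      Module.finrank k (mixedSpan r Finset.univ i) := by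
  rw [mixedSpan_eq_span_range_weightProd]
  refine finrank_span_range_eq_of_forall_sum_eq_zero_iff _ _ fun c => ?_
  have key : ∀ g : Matrix (Fin 2) (Fin 2) k,
      ∑ f, c f * (if (zeroSet f).card = i then ∏ j, (g * v) (f j) j else 0) = (∏ j, d j) *
        ∑ f, c f * (if (zeroSet f).card = i then
          ∏ j, (g (f j) 1 - r j * (g (f j) 0 - t * g (f j) 1)) else 0) := by
    intro g
    have hg : ∀ e j, (g * v) e j = d j * (g e 1 - r j * (g e 0 - t * g e 1)) := fun e j => by
      rw [Matrix.mul_apply, Fin.sum_univ_two, h0, h1]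
      ring
    rw [Finset.mul_sum]
    refine Finset.sum_congr rfl fun f _ => ?_
    simp only [hg]
    rw [Finset.prod_mul_distrib, mul_left_comm (∏ j, d j), mul_ite (_ = i) (∏ j, d j), mul_zero]
  constructor
  · intro hu
    refine eq_zero_of_forall_ne_evalEval_eq_zero fun x y hxy => ?_
    have hunit : IsUnit (!![1 + t * x, x; 1 + t * y, y] : Matrix (Fin 2) (Fin 2) k) := by
      rw [Matrix.isUnit_iff_isUnit_det, Matrix.det_fin_two_of, isUnit_iff_ne_zero]
      intro h
      exact hxy (by linear_combination -h)
    obtain ⟨g, hg⟩ := hunit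
    have h2 := hu g
    rw [key, mul_eq_zero, or_iff_right (Finset.prod_ne_zero_iff.2 fun j _ => hd j), hg] at h2
    have h3 := sum_weight_eq_evalEval r i c ![x, y] (fun _ => 1) fun _ => one_ne_zero
    have h4 : ∀ e : Fin 2, (!![1 + t * x, x; 1 + t * y, y] : Matrix (Fin 2) (Fin 2) k) e 1 =
        ![x, y] e := by
      intro e
      fin_cases e <;> rfl
    have h5 : ∀ e : Fin 2, (!![1 + t * x, x; 1 + t * y, y] : Matrix (Fin 2) (Fin 2) k) e 0 =
        1 + t * ![x, y] e := by
      intro e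
      fin_cases e <;> rfl
    simp only [h4, h5, add_sub_cancel_right] at h2
    rw [h2] at h3
    simpa using h3.symm
  · intro hF g
    rw [key, sum_weight_eq_zero r i c hF (fun e => g.1 e 1) (fun e => g.1 e 0 - t * g.1 e 1),
      mul_zero]

lemma exists_forall_mul_add_ne_zero [Infinite k] (v : Matrix (Fin 2) (Fin n) k)
    (hnz : ∀ j : Fin n, (fun i => v i j) ≠ 0) : ∃ t : k, ∀ j, t * v 0 j + v 1 j ≠ 0 := by
  have hp : (∏ j, (C (v 0 j) * X + C (v 1 j)) : k[X]) ≠ 0 := by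
    refine Finset.prod_ne_zero_iff.2 fun j _ h => hnz j ?_
    have h0 := congrArg (fun q => coeff q 0) h
    have h1 := congrArg (fun q => coeff q 1) h
    funext i
    fin_cases i
    · simpa using h1
    · simpa using h0
  by_contra! hcon
  refine hp (Polynomial.funext fun t => ?_)
  obtain ⟨j, hj⟩ := hcon t
  rw [eval_prod, eval_zero]
  refine Finset.prod_eq_zero (Finset.mem_univ j) ?_
  simpa [mul_comm t] using hj

lemma mem_parClass_iff (v : Matrix (Fin 2) (Fin n) k) (d r : Fin n → k) (t : k)
    (hd : ∀ j, d j ≠ 0) (h0 : ∀ j, v 0 j = -(d j * r j))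
    (h1 : ∀ j, v 1 j = d j * (1 + t * r j)) (j j' : Fin n) :
    j' ∈ parClass k v j ↔ r j' = r j := by
  rw [parClass, Finset.mem_filter, and_iff_right (Finset.mem_univ _), not_iff_comm,
    LinearIndependent.pair_iff]
  constructor
  · intro hr x y hxy
    have e0 := congrFun hxy 0
    have e1 := congrFun hxy 1
    simp only [Pi.add_apply, Pi.smul_apply, smul_eq_mul, Pi.zero_apply, h0, h1] at e0 e1
    have hs : x * d j + y * d j' = 0 := by linear_combination e1 + t * e0
    have hy : y * (d j' * (r j' - r j)) = 0 := by linear_combination -e0 - r j * hs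
    have hy0 : y = 0 := by
      simpa [hd, sub_eq_zero, hr] using hy
    subst hy0
    simpa [hd] using hs
  · intro h hr
    refine hd j' (h (d j') (-d j) ?_).1
    funext i
    fin_cases i
    · change d j' * v 0 j + -d j * v 0 j' = 0
      rw [h0, h0, hr]
      ring
    · change d j' * v 1 j + -d j * v 1 j' = 0
      rw [h1, h1, hr]
      ring

lemma sum_parConj_eq_truncCard (v : Matrix (Fin 2) (Fin n) k) (r : Fin n → k)
    (h : ∀ j j', j' ∈ parClass k v j ↔ r j' = r j) (l : ℕ) :
    ∑ m ∈ Finset.Icc 1 l, parConj k v m = truncCard r Finset.univ l := by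
  have hclass : parClass k v = (fun ρ => Finset.univ.filter fun j => r j = ρ) ∘ r := by
    funext j
    ext j'
    simp [h]
  have hinj : Set.InjOn (fun ρ => Finset.univ.filter fun j => r j = ρ)
      (Finset.univ.image r : Set k) := by
    intro ρ hρ σ _ hρσ
    obtain ⟨j, -, rfl⟩ := Finset.mem_image.1 (Finset.mem_coe.1 hρ)
    have : j ∈ Finset.univ.filter fun j' => r j' = σ :=
      (Finset.ext_iff.1 hρσ j).1 (by simp)
    simpa using this
  have hconj : ∀ m, parConj k v m = ∑ ρ ∈ Finset.univ.image r,
      if m ≤ (Finset.univ.filter fun j => r j = ρ).card then 1 else 0 := by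
    intro m
    rw [parConj, hclass, ← Finset.image_image, Finset.card_filter,
      Finset.sum_image hinj]
  simp only [hconj]
  rw [Finset.sum_comm, truncCard]
  refine Finset.sum_congr rfl fun ρ _ => ?_
  rw [← Finset.card_filter]
  have : (Finset.Icc 1 l).filter (fun m => m ≤ (Finset.univ.filter fun j => r j = ρ).card) =
      Finset.Icc 1 (min (Finset.univ.filter fun j => r j = ρ).card l) := by
    ext m
    simp only [Finset.mem_filter, Finset.mem_Icc, le_min_iff]
    tauto
  rw [this, Nat.card_Icc, Nat.add_sub_cancel]

lemma sum_mul_sum_range_min {R : Type*} [CommSemiring R] (n : ℕ) (w c : ℕ → R) :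
    ∑ i ∈ Finset.range (n + 1), w i * ∑ l ∈ Finset.range (min i (n - i) + 1), c l =
      c 0 * ∑ i ∈ Finset.range (n + 1), w i +
        ∑ l ∈ Finset.Icc 1 (n / 2), c l * ∑ i ∈ Finset.Icc l (n - l), w i := by
  have hsplit : ∀ i, ∑ l ∈ Finset.range (min i (n - i) + 1), c l =
      c 0 + ∑ l ∈ Finset.Icc 1 (min i (n - i)), c l := by
    intro i
    rw [Finset.range_eq_Ico, Finset.sum_eq_sum_Ico_succ_bot (Nat.succ_pos _)]
    rfl
  simp only [hsplit, mul_add, Finset.sum_add_distrib, Finset.mul_sum]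
  congr 1
  · exact Finset.sum_congr rfl fun i _ => mul_comm _ _
  · rw [Finset.sum_comm' (t' := Finset.Icc 1 (n / 2)) (s' := fun l => Finset.Icc l (n - l))]
    · exact Finset.sum_congr rfl fun l _ => Finset.sum_congr rfl fun i _ => mul_comm _ _
    · intro i l
      simp only [Finset.mem_range, Finset.mem_Icc]
      omega

end Comparison

end TensorCharacter

/-- The character of the tensor module of a rank-2 configuration with no zero columns:
the trace of `diag(a,b)` on `G(v)` is
`s_{(n,0)}(a,b) + ∑_ℓ max(μ'_1+⋯+μ'_ℓ − 2ℓ + 1, 0)·s_{(n−ℓ,ℓ)}(a,b)`. -/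
theorem character_of_tensor_module_rank_two
    {k : Type*} [Field k] [CharZero k] {n : ℕ}
    (v : Matrix (Fin 2) (Fin n) k)
    (hrank : v.rank = 2)
    (hnz : ∀ j : Fin n, (fun i => v i j) ≠ 0)
    (a b : kˣ) :
    ∃ hpres : ∀ x ∈ tensMod k v,
        diagAct k (Matrix.diagonal ![(a : k), (b : k)]) x ∈ tensMod k v,
      LinearMap.trace k ↥(tensMod k v)
          ((diagAct k (n := n) (Matrix.diagonal ![(a : k), (b : k)])).restrict hpres) =
        (∑ i ∈ Finset.range (n + 1), (a : k) ^ i * (b : k) ^ (n - i)) +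
          ∑ l ∈ Finset.Icc 1 (n / 2),
            (((∑ m ∈ Finset.Icc 1 l, parConj k v m) - (2 * l - 1) : ℕ) : k) *
              ∑ i ∈ Finset.Icc l (n - l), (a : k) ^ i * (b : k) ^ (n - i) := by
  obtain ⟨t, ht⟩ := TensorCharacter.exists_forall_mul_add_ne_zero v hnz
  set d : Fin n → k := fun j => t * v 0 j + v 1 j with hd
  set r : Fin n → k := fun j => -v 0 j / d j with hr
  have h0 : ∀ j, v 0 j = -(d j * r j) := fun j => by
    rw [hr, mul_div_cancel₀ _ (ht j), neg_neg]
  have h1 : ∀ j, v 1 j = d j * (1 + t * r j) := fun j => by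
    linear_combination (-t) * h0 j
  refine ⟨fun x hx => TensorCharacter.diagAct_diagonal_mem_tensMod v a.ne_zero b.ne_zero hx, ?_⟩
  have hweight : ∀ i ∈ Finset.range (n + 1), (a : k) ^ i * (b : k) ^ (n - i) *
      (Module.finrank k ((tensMod k v).map (TensorCharacter.weightProj k n i)) : k) =
      (a : k) ^ i * (b : k) ^ (n - i) * ∑ l ∈ Finset.range (min i (n - i) + 1),
        ((TensorCharacter.truncCard r Finset.univ l + 1 - 2 * l : ℕ) : k) := by
    intro i hi
    rw [TensorCharacter.finrank_map_weightProj_tensMod,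
      TensorCharacter.finrank_weightSpan_eq_finrank_mixedSpan v d r t ht h0 h1,
      TensorCharacter.finrank_mixedSpan r (by
        rw [Finset.card_univ, Fintype.card_fin]
        exact Nat.le_of_lt_succ (Finset.mem_range.1 hi)),
      Finset.card_univ, Fintype.card_fin, Nat.cast_sum]
  rw [TensorCharacter.trace_diagAct_restrict, Finset.sum_congr rfl hweight,
    TensorCharacter.sum_mul_sum_range_min]
  congr 1
  · simp [TensorCharacter.truncCard]
  · refine Finset.sum_congr rfl fun l hl => ?_
    rw [TensorCharacter.sum_parConj_eq_truncCard v r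
      (TensorCharacter.mem_parClass_iff v d r t ht h0 h1)]
    have := (Finset.mem_Icc.1 hl).1
    congr 2
    omega
end
end

section
/- Let v ∈ k^{r×n} and 0 ≤ m ≤ n. Let e_m = ∑_{σ,τ} sgn(σ)·(στ) ∈ k[S_n], the sum over all σ permuting {1,…,m} and all τ permuting {m+1,…,n}, acting on (k^r)^{⊗n} via the factor-permutation action. Then the k-dimension of the span of {e_m·(π·v^⊗) : π ∈ S_n} (that is, of e_m·𝔖(v)) equals the number of nbc subsets of {1,…,n} of size m with respect to the matroid M(v). (For m equal to the rank of v this is the number of nbc bases of M(v), which is the multiplicity of the hook Specht module λ_{n,m} = (n−m+1,1^{m−1}) in 𝔖(v).) -/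
noncomputable section

/-- The action of a permutation `σ ∈ S_n` on `(k^r)^{⊗n}` by permuting tensor
factors. -/
def permAct (k : Type*) [Field k] {r n : ℕ} (σ : Equiv.Perm (Fin n)) :
    (PiTensorProduct k fun _ : Fin n => Fin r → k) →ₗ[k]
      (PiTensorProduct k fun _ : Fin n => Fin r → k) :=
  (PiTensorProduct.reindex k (fun _ : Fin n => Fin r → k) σ).toLinearMap

/-- The group algebra element `e_m = ∑_{σ,τ} sgn(σ)·(στ)` acting on `(k^r)^{⊗n}`,
where `σ` ranges over permutations of the first `m` letters and `τ` over permutations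
of the remaining letters. -/
def symmetrizer (k : Type*) [Field k] (r n m : ℕ) :
    (PiTensorProduct k fun _ : Fin n => Fin r → k) →ₗ[k]
      (PiTensorProduct k fun _ : Fin n => Fin r → k) :=
  ∑ σ ∈ Finset.univ.filter (fun σ : Equiv.Perm (Fin n) =>
      ∀ i : Fin n, ¬ (i : ℕ) < m → σ i = i),
    ∑ τ ∈ Finset.univ.filter (fun τ : Equiv.Perm (Fin n) =>
      ∀ i : Fin n, (i : ℕ) < m → τ i = i),
      ((Equiv.Perm.sign σ : ℤ) : k) • permAct k (r := r) (σ * τ)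

/-- `S` indexes a linearly independent set of columns of `v`. -/
def ColsIndep (k : Type*) [Field k] {r n : ℕ} (v : Matrix (Fin r) (Fin n) k)
    (S : Finset (Fin n)) : Prop :=
  LinearIndependent k (fun j : S => fun i => v i (j : Fin n))

/-- `C` is a circuit of the matroid of `v`: a minimal dependent set. -/
def IsCircuitOf (k : Type*) [Field k] {r n : ℕ} (v : Matrix (Fin r) (Fin n) k)
    (C : Finset (Fin n)) : Prop :=
  ¬ ColsIndep k v C ∧ ∀ D : Finset (Fin n), D ⊂ C → ColsIndep k v D

/-- `S` is an nbc set of the matroid of `v`: it contains no broken circuit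
`C ∖ {min C}`. -/
def IsNbc (k : Type*) [Field k] {r n : ℕ} (v : Matrix (Fin r) (Fin n) k)
    (S : Finset (Fin n)) : Prop :=
  ∀ B : Finset (Fin n),
    (∃ C : Finset (Fin n), IsCircuitOf k v C ∧ ∃ hC : C.Nonempty, B = C.erase (C.min' hC))
    → ¬ B ⊆ S

section Nbc

variable {k : Type*} [Field k] {r n : ℕ} {v : Matrix (Fin r) (Fin n) k}

theorem colsIndep_iff_linearIndepOn {S : Finset (Fin n)} :
    ColsIndep k v S ↔ LinearIndepOn k (fun j i => v i j) (S : Set (Fin n)) :=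
  Iff.rfl

theorem exists_isCircuitOf_subset {S : Finset (Fin n)} (hS : ¬ ColsIndep k v S) :
    ∃ C ⊆ S, IsCircuitOf k v C := by
  induction S using Finset.strongInduction with
  | H S ih =>
    by_cases h : ∃ D, D ⊂ S ∧ ¬ ColsIndep k v D
    · obtain ⟨D, hDS, hD⟩ := h
      obtain ⟨C, hCD, hC⟩ := ih D hDS hD
      exact ⟨C, hCD.trans hDS.subset, hC⟩
    · push Not at h
      exact ⟨S, subset_rfl, hS, h⟩

theorem IsCircuitOf.nonempty {C : Finset (Fin n)} (hC : IsCircuitOf k v C) : C.Nonempty := by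
  rw [Finset.nonempty_iff_ne_empty]
  rintro rfl
  refine hC.1 ?_
  rw [colsIndep_iff_linearIndepOn, Finset.coe_empty]
  exact linearIndepOn_empty k _

/-- A vector of a circuit is a linear combination of the other ones. -/
theorem IsCircuitOf.exists_eq_sum {C : Finset (Fin n)} (hC : IsCircuitOf k v C) {c : Fin n}
    (hc : c ∈ C) :
    ∃ b : Fin n → k, (fun i => v i c) = ∑ j ∈ C.erase c, b j • (fun i => v i j) := by
  have hind := colsIndep_iff_linearIndepOn.1 (hC.2 _ (Finset.erase_ssubset hc))
  have hdep := fun h => hC.1 (colsIndep_iff_linearIndepOn.2 h)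
  have hmem : (fun i => v i c) ∈
      Submodule.span k ((fun (j : Fin n) (i : Fin r) => v i j) '' (C.erase c : Finset (Fin n))) := by
    by_contra h
    apply hdep
    have := hind.insert h
    rwa [← Finset.coe_insert, Finset.insert_erase hc] at this
  obtain ⟨b, hb⟩ := (Submodule.mem_span_image_finset_iff_exists_fun' k).1 hmem
  exact ⟨b, hb.symm⟩

theorem IsNbc.colsIndep {S : Finset (Fin n)} (hS : IsNbc k v S) : ColsIndep k v S := by
  by_contra h
  obtain ⟨C, hCS, hC⟩ := exists_isCircuitOf_subset h
  exact hS _ ⟨C, hC, hC.nonempty, rfl⟩ ((Finset.erase_subset _ _).trans hCS)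

/-- No vector is spanned by vectors of an nbc set with larger indices. -/
theorem IsNbc.notMem_span {S A : Finset (Fin n)} (hS : IsNbc k v S) (hA : A ⊆ S) {c : Fin n}
    (hc : ∀ a ∈ A, c < a) :
    (fun i => v i c) ∉
      Submodule.span k ((fun (j : Fin n) (i : Fin r) => v i j) '' (A : Set (Fin n))) := by
  intro hmem
  have hcA : c ∉ A := fun h => lt_irrefl _ (hc c h)
  have hdep : ¬ ColsIndep k v (insert c A) := by
    rw [colsIndep_iff_linearIndepOn, Finset.coe_insert,
      linearIndepOn_insert (by exact_mod_cast hcA)]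
    exact fun h => h.2 hmem
  obtain ⟨C, hCA, hC⟩ := exists_isCircuitOf_subset hdep
  refine hS _ ⟨C, hC, hC.nonempty, rfl⟩ fun x hx => hA ?_
  obtain ⟨hne, hxC⟩ := Finset.mem_erase.1 hx
  obtain rfl | hxA := Finset.mem_insert.1 (hCA hxC)
  · exfalso
    obtain hmin | hmin := Finset.mem_insert.1 (hCA (C.min'_mem hC.nonempty))
    · exact hne hmin.symm
    · exact absurd (C.min'_le x hxC) (not_le.2 (hc _ hmin))
  · exact hxA

/-- Two nbc sets, the first listed increasingly by `s`, the second by `t`, agree if the vector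
at `t p` is a combination of the vectors at `s q`, `p ≤ q`, with nonzero coefficient at `s p`. -/
theorem IsNbc.eq_of_adapted {m : ℕ} {S S' : Finset (Fin n)} (hS : IsNbc k v S)
    (hS' : IsNbc k v S') {s t : Fin m → Fin n} (hs : StrictMono s)
    (hsS : ∀ p, s p ∈ S) (htS : ∀ p, t p ∈ S') (a : Fin m → Fin m → k) (ha : ∀ p, a p p ≠ 0)
    (hst : ∀ p, (fun i => v i (t p)) = ∑ q ∈ Finset.Ici p, a p q • (fun i => v i (s q))) :
    t = s := by
  have key : ∀ p : Fin m, (∀ q, p < q → t q = s q) → t p = s p := by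
    intro p ih
    have hsplit := hst p
    rw [← Finset.Ioi_insert, Finset.sum_insert (by simp)] at hsplit
    obtain h | h | h := lt_trichotomy (t p) (s p)
    · exfalso
      refine hS.notMem_span (A := (Finset.Ici p).image s) (c := t p) ?_ ?_ ?_
      · intro x hx
        obtain ⟨q, -, rfl⟩ := Finset.mem_image.1 hx
        exact hsS q
      · intro x hx
        obtain ⟨q, hq, rfl⟩ := Finset.mem_image.1 hx
        exact h.trans_le (hs.monotone (Finset.mem_Ici.1 hq))
      · rw [hst p]
        refine Submodule.sum_mem _ fun q hq => Submodule.smul_mem _ _ (Submodule.subset_span ?_)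
        exact ⟨s q, by simpa using ⟨q, Finset.mem_Ici.1 hq, rfl⟩, rfl⟩
    · exact h
    · exfalso
      refine hS'.notMem_span (A := (Finset.Ici p).image t) (c := s p) ?_ ?_ ?_
      · intro x hx
        obtain ⟨q, -, rfl⟩ := Finset.mem_image.1 hx
        exact htS q
      · intro x hx
        obtain ⟨q, hq, rfl⟩ := Finset.mem_image.1 hx
        obtain rfl | hpq := (Finset.mem_Ici.1 hq).eq_or_lt
        · exact h
        · rw [ih q hpq]
          exact hs hpq
      · have hsp : (fun i => v i (s p)) = (a p p)⁻¹ • ((fun i => v i (t p)) -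
            ∑ q ∈ Finset.Ioi p, a p q • (fun i => v i (s q))) := by
          rw [hsplit, add_sub_cancel_right, smul_smul, inv_mul_cancel₀ (ha p), one_smul]
        rw [hsp]
        refine Submodule.smul_mem _ _ (Submodule.sub_mem _ (Submodule.subset_span ?_)
          (Submodule.sum_mem _ fun q hq => Submodule.smul_mem _ _ (Submodule.subset_span ?_)))
        · exact ⟨t p, by simpa using ⟨p, le_rfl, rfl⟩, rfl⟩
        · have hpq := Finset.mem_Ioi.1 hq
          exact ⟨s q, by simpa using ⟨q, hpq.le, ih q hpq⟩, rfl⟩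
  funext p
  induction p using WellFoundedGT.induction with
  | ind p ih => exact key p ih

end Nbc

section Symmetrizer

variable {k : Type*} [Field k] {r n m : ℕ}

theorem symmetrizer_tprod (w : Fin n → Fin r → k) :
    symmetrizer k r n m (PiTensorProduct.tprod k w) =
      ∑ σ ∈ Finset.univ.filter (fun σ : Equiv.Perm (Fin n) =>
        ∀ i : Fin n, ¬ (i : ℕ) < m → σ i = i),
      ∑ τ ∈ Finset.univ.filter (fun τ : Equiv.Perm (Fin n) =>
        ∀ i : Fin n, (i : ℕ) < m → τ i = i),
        ((Equiv.Perm.sign σ : ℤ) : k) • PiTensorProduct.tprod k (w ∘ ⇑(σ * τ)⁻¹) := by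
  simp only [symmetrizer, LinearMap.sum_apply, LinearMap.smul_apply, permAct,
    LinearEquiv.coe_coe, PiTensorProduct.reindex_tprod]
  rfl

theorem mul_comm_of_fixes {ρ τ : Equiv.Perm (Fin n)} (hρ : ∀ i : Fin n, ¬ (i : ℕ) < m → ρ i = i)
    (hτ : ∀ i : Fin n, (i : ℕ) < m → τ i = i) : ρ * τ = τ * ρ := by
  refine Equiv.Perm.Disjoint.commute fun i => ?_
  by_cases h : (i : ℕ) < m
  · exact Or.inr (hτ i h)
  · exact Or.inl (hρ i h)

theorem fixes_mul {p : Fin n → Prop} {σ ρ : Equiv.Perm (Fin n)} (hσ : ∀ i, p i → σ i = i)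
    (hρ : ∀ i, p i → ρ i = i) (i : Fin n) (hi : p i) : (σ * ρ) i = i := by
  rw [Equiv.Perm.mul_apply, hρ i hi, hσ i hi]

theorem fixes_inv {p : Fin n → Prop} {σ : Equiv.Perm (Fin n)} (hσ : ∀ i, p i → σ i = i)
    (i : Fin n) (hi : p i) : σ⁻¹ i = i :=
  Equiv.Perm.inv_eq_iff_eq.2 (hσ i hi).symm

theorem symmetrizer_tprod_comp_of_fixes_not_lt (w : Fin n → Fin r → k) {ρ : Equiv.Perm (Fin n)}
    (hρ : ∀ i : Fin n, ¬ (i : ℕ) < m → ρ i = i) :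
    symmetrizer k r n m (PiTensorProduct.tprod k (w ∘ ρ)) =
      ((Equiv.Perm.sign ρ : ℤ) : k) • symmetrizer k r n m (PiTensorProduct.tprod k w) := by
  rw [symmetrizer_tprod, symmetrizer_tprod, Finset.smul_sum]
  refine Finset.sum_equiv (Equiv.mulRight ρ⁻¹) (fun σ => ?_) fun σ _ => ?_
  · simp only [Finset.mem_filter, Finset.mem_univ, true_and, Equiv.coe_mulRight]
    refine ⟨fun h => fixes_mul h (fixes_inv hρ), fun h => ?_⟩
    simpa using fixes_mul h hρ
  · rw [Finset.smul_sum]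
    refine Finset.sum_congr rfl fun τ hτ => ?_
    have hτ' := (Finset.mem_filter.1 hτ).2
    have hcomm := mul_comm_of_fixes (fixes_inv hρ) hτ'
    have hperm : (w ∘ ρ) ∘ ⇑(σ * τ)⁻¹ = w ∘ ⇑(Equiv.mulRight ρ⁻¹ σ * τ)⁻¹ := by
      rw [Function.comp_assoc, ← Equiv.Perm.coe_mul, Equiv.coe_mulRight, mul_assoc, hcomm]
      simp [mul_assoc]
    rw [hperm, smul_smul]
    congr 1
    rcases Int.units_eq_one_or (Equiv.Perm.sign ρ) with h | h <;> simp [h]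

theorem symmetrizer_tprod_comp_of_fixes_lt (w : Fin n → Fin r → k) {ρ : Equiv.Perm (Fin n)}
    (hρ : ∀ i : Fin n, (i : ℕ) < m → ρ i = i) :
    symmetrizer k r n m (PiTensorProduct.tprod k (w ∘ ρ)) =
      symmetrizer k r n m (PiTensorProduct.tprod k w) := by
  rw [symmetrizer_tprod, symmetrizer_tprod]
  refine Finset.sum_congr rfl fun σ _ => ?_
  refine Finset.sum_equiv (Equiv.mulRight ρ⁻¹) (fun τ => ?_) fun τ _ => ?_
  · simp only [Finset.mem_filter, Finset.mem_univ, true_and, Equiv.coe_mulRight]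
    refine ⟨fun h => fixes_mul h (fixes_inv hρ), fun h => ?_⟩
    simpa using fixes_mul h hρ
  · have hperm : (w ∘ ρ) ∘ ⇑(σ * τ)⁻¹ = w ∘ ⇑(σ * Equiv.mulRight ρ⁻¹ τ)⁻¹ := by
      rw [Function.comp_assoc, ← Equiv.Perm.coe_mul, Equiv.coe_mulRight]
      simp [mul_assoc]
    rw [hperm]

/-- A permutation preserving the first `m` letters acts by a sign under the symmetrizer. -/
theorem exists_symmetrizer_tprod_comp_eq_smul (w : Fin n → Fin r → k) {ρ : Equiv.Perm (Fin n)}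
    (hρ : ∀ i : Fin n, (ρ i : ℕ) < m ↔ (i : ℕ) < m) :
    ∃ ε : k, symmetrizer k r n m (PiTensorProduct.tprod k (w ∘ ρ)) =
      ε • symmetrizer k r n m (PiTensorProduct.tprod k w) := by
  set ρ₁ : Equiv.Perm (Fin n) :=
    Equiv.Perm.ofSubtype (ρ.subtypePerm (p := fun i : Fin n => (i : ℕ) < m) hρ) with hρ₁
  have h₁ : ∀ i : Fin n, ¬ (i : ℕ) < m → ρ₁ i = i := fun i hi =>
    Equiv.Perm.ofSubtype_subtypePerm_of_not_mem hρ hi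
  have h₂ : ∀ i : Fin n, (i : ℕ) < m → (ρ₁⁻¹ * ρ) i = i := fun i hi => by
    rw [Equiv.Perm.mul_apply, Equiv.Perm.inv_eq_iff_eq]
    exact (Equiv.Perm.ofSubtype_subtypePerm_of_mem (p := fun i : Fin n => (i : ℕ) < m) hρ hi).symm
  refine ⟨((Equiv.Perm.sign ρ₁ : ℤ) : k), ?_⟩
  rw [← symmetrizer_tprod_comp_of_fixes_not_lt w h₁,
    ← symmetrizer_tprod_comp_of_fixes_lt (w ∘ ρ₁) h₂, Function.comp_assoc, ← Equiv.Perm.coe_mul,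
    mul_inv_cancel_left]

theorem symmetrizer_tprod_eq_zero [CharZero k] {w : Fin n → Fin r → k} {p q : Fin n}
    (hp : (p : ℕ) < m) (hq : (q : ℕ) < m) (hpq : p ≠ q) (hw : w p = w q) :
    symmetrizer k r n m (PiTensorProduct.tprod k w) = 0 := by
  have hswap : w ∘ Equiv.swap p q = w := by
    funext i
    obtain rfl | hip := eq_or_ne i p
    · simp [hw]
    obtain rfl | hiq := eq_or_ne i q
    · simp [hw]
    simp [Equiv.swap_apply_of_ne_of_ne hip hiq]
  have h := symmetrizer_tprod_comp_of_fixes_not_lt (m := m) w (ρ := Equiv.swap p q) fun i hi =>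
    Equiv.swap_apply_of_ne_of_ne (fun h => hi (h ▸ hp)) (fun h => hi (h ▸ hq))
  rw [hswap, Equiv.Perm.sign_swap hpq] at h
  have h2 : (2 : k) • symmetrizer k r n m (PiTensorProduct.tprod k w) = 0 := by
    have hone : (((-1 : ℤˣ) : ℤ) : k) = -1 := by simp
    rw [hone] at h
    calc (2 : k) • symmetrizer k r n m (PiTensorProduct.tprod k w)
        = (1 + -1 : k) • symmetrizer k r n m (PiTensorProduct.tprod k w) := by
          rw [two_smul, add_smul, one_smul, ← h]
      _ = 0 := by rw [add_neg_cancel, zero_smul]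
  exact (smul_eq_zero.1 h2).resolve_left two_ne_zero

theorem symmetrizer_tprod_update_sum (w : Fin n → Fin r → k) (q : Fin n) (P : Finset (Fin n))
    (b : Fin n → k) (u : Fin n → Fin r → k) :
    symmetrizer k r n m (PiTensorProduct.tprod k (Function.update w q (∑ p ∈ P, b p • u p))) =
      ∑ p ∈ P, b p •
        symmetrizer k r n m (PiTensorProduct.tprod k (Function.update w q (u p))) := by
  rw [MultilinearMap.map_update_sum, map_sum]
  simp only [MultilinearMap.map_update_smul, map_smul]

theorem symmetrizer_tprod_eq_zero_of_eq_sum [CharZero k] {w : Fin n → Fin r → k} {q : Fin n}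
    (hq : (q : ℕ) < m) {P : Finset (Fin n)} (hP : ∀ p ∈ P, (p : ℕ) < m) (hqP : q ∉ P)
    {b : Fin n → k} (hw : w q = ∑ p ∈ P, b p • w p) :
    symmetrizer k r n m (PiTensorProduct.tprod k w) = 0 := by
  rw [← Function.update_eq_self q w, hw, symmetrizer_tprod_update_sum]
  refine Finset.sum_eq_zero fun p hp => ?_
  have hpq : p ≠ q := fun h => hqP (h ▸ hp)
  rw [symmetrizer_tprod_eq_zero (hP p hp) hq hpq (by simp [hpq]), smul_zero]

/-- The exchange relation between the alternating and the symmetric part. -/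
theorem symmetrizer_tprod_eq_sum_swap [CharZero k] {w : Fin n → Fin r → k} {q : Fin n}
    (hq : ¬ (q : ℕ) < m) {P : Finset (Fin n)} (hP : ∀ p ∈ P, (p : ℕ) < m)
    {b : Fin n → k} (hw : w q = ∑ p ∈ P, b p • w p) :
    symmetrizer k r n m (PiTensorProduct.tprod k w) =
      ∑ p ∈ P, symmetrizer k r n m (PiTensorProduct.tprod k (w ∘ Equiv.swap p q)) := by
  conv_lhs => rw [← Function.update_eq_self q w, hw, symmetrizer_tprod_update_sum]
  refine Finset.sum_congr rfl fun p hp => ?_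
  have hpq : p ≠ q := fun h => hq (h ▸ hP p hp)
  have hswap : w ∘ Equiv.swap p q =
      Function.update (Function.update w q (w p)) p (∑ p ∈ P, b p • w p) := by
    rw [← hw]
    funext i
    obtain rfl | hip := eq_or_ne i p
    · simp
    obtain rfl | hiq := eq_or_ne i q
    · simp [hip]
    simp [Equiv.swap_apply_of_ne_of_ne hip hiq, hip, hiq]
  rw [hswap, symmetrizer_tprod_update_sum, Finset.sum_eq_single_of_mem p hp]
  · congr 3
    rw [eq_comm, Function.update_eq_self_iff]
    simp [hpq]
  · intro p' hp' hne
    have hp'q : p' ≠ q := fun h => hq (h ▸ hP p' hp')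
    rw [symmetrizer_tprod_eq_zero (hP p hp) (hP p' hp') hne.symm (by simp [hne, hp'q]), smul_zero]

theorem mul_apply_lt_iff {σ τ : Equiv.Perm (Fin n)} (hσ : ∀ i : Fin n, ¬ (i : ℕ) < m → σ i = i)
    (hτ : ∀ i : Fin n, (i : ℕ) < m → τ i = i) (i : Fin n) :
    ((σ * τ) i : ℕ) < m ↔ (i : ℕ) < m := by
  rw [Equiv.Perm.mul_apply]
  by_cases hi : (i : ℕ) < m
  · rw [hτ i hi]
    refine iff_of_true ?_ hi
    by_contra h
    exact h (by rwa [σ.injective (hσ _ h)])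
  · have h : ¬ (τ i : ℕ) < m := fun h => hi (by rwa [← τ.injective (hτ _ h)])
    rw [hσ _ h]
    exact iff_of_false h hi

end Symmetrizer

section Arrangement

variable {n m : ℕ}

theorem exists_perm_castLE_eq (hm : m ≤ n) {u : Fin m → Fin n} (hu : Function.Injective u) :
    ∃ π : Equiv.Perm (Fin n), ∀ p, π (Fin.castLE hm p) = u p := by
  classical
  let e : {x // x ∈ Set.range (Fin.castLE hm)} ≃ {x // x ∈ Set.range u} :=
    (Equiv.ofInjective _ (Fin.castLE_injective hm)).symm.trans (Equiv.ofInjective u hu)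
  refine ⟨e.extendSubtype, fun p => ?_⟩
  rw [Equiv.extendSubtype_apply_of_mem e _ ⟨p, rfl⟩]
  have : (⟨Fin.castLE hm p, ⟨p, rfl⟩⟩ : {x // x ∈ Set.range (Fin.castLE hm)}) =
      Equiv.ofInjective _ (Fin.castLE_injective hm) p := rfl
  rw [this]
  simp [e]

theorem exists_arrangement (hm : m ≤ n) (S : Finset (Fin n)) (hS : S.card = m) :
    ∃ π : Equiv.Perm (Fin n), ∀ p, π (Fin.castLE hm p) = S.orderEmbOfFin hS p :=
  exists_perm_castLE_eq hm (S.orderEmbOfFin hS).injective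

/-- The set of entries of an arrangement in the first `m` positions. -/
def headSet (m : ℕ) (π : Equiv.Perm (Fin n)) : Finset (Fin n) :=
  (Finset.univ.filter fun i : Fin n => (i : ℕ) < m).image π

theorem mem_headSet {π : Equiv.Perm (Fin n)} {j : Fin n} :
    j ∈ headSet m π ↔ ((π⁻¹ j : Fin n) : ℕ) < m := by
  simp only [headSet, Finset.mem_image, Finset.mem_filter, Finset.mem_univ, true_and]
  constructor
  · rintro ⟨i, hi, rfl⟩
    simpa using hi
  · exact fun h => ⟨_, h, by simp⟩

theorem apply_mem_headSet {π : Equiv.Perm (Fin n)} {i : Fin n} :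
    π i ∈ headSet m π ↔ (i : ℕ) < m := by
  simp [mem_headSet]

theorem headSet_mul_inv {π σ τ : Equiv.Perm (Fin n)}
    (hσ : ∀ i : Fin n, ¬ (i : ℕ) < m → σ i = i) (hτ : ∀ i : Fin n, (i : ℕ) < m → τ i = i) :
    headSet m (π * (σ * τ)⁻¹) = headSet m π := by
  ext j
  rw [mem_headSet, mem_headSet, mul_inv_rev, inv_inv, Equiv.Perm.mul_apply]
  exact mul_apply_lt_iff hσ hτ _

theorem card_headSet (hm : m ≤ n) (π : Equiv.Perm (Fin n)) : (headSet m π).card = m := by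
  rw [headSet, Finset.card_image_of_injective _ π.injective, Fin.card_filter_val_lt]
  exact min_eq_right hm

theorem headSet_eq_of_orderEmbOfFin (hm : m ≤ n) {S : Finset (Fin n)} {hS : S.card = m}
    {π : Equiv.Perm (Fin n)} (hπ : ∀ p, π (Fin.castLE hm p) = S.orderEmbOfFin hS p) :
    headSet m π = S := by
  refine Finset.eq_of_subset_of_card_le (fun j hj => ?_) (by rw [card_headSet hm, hS])
  rw [mem_headSet] at hj
  have := hπ ⟨_, hj⟩
  have h2 : Fin.castLE hm ⟨_, hj⟩ = π⁻¹ j := rfl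
  rw [h2, ← Equiv.Perm.mul_apply, mul_inv_cancel, Equiv.Perm.one_apply] at this
  rw [this]
  exact S.orderEmbOfFin_mem hS _

theorem sum_headSet_swap_lt {π : Equiv.Perm (Fin n)} {p q : Fin n} (hp : (p : ℕ) < m)
    (hq : ¬ (q : ℕ) < m) (hlt : π q < π p) :
    ∑ j ∈ headSet m (π * Equiv.swap p q), (j : ℕ) < ∑ j ∈ headSet m π, (j : ℕ) := by
  have hsum : ∀ π : Equiv.Perm (Fin n), ∑ j ∈ headSet m π, (j : ℕ) =
      ∑ i ∈ Finset.univ.filter fun i : Fin n => (i : ℕ) < m, (π i : ℕ) := fun π =>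
    Finset.sum_image fun _ _ _ _ h => π.injective h
  rw [hsum, hsum]
  refine Finset.sum_lt_sum (fun i hi => ?_) ⟨p, by simpa using hp, by simpa using hlt⟩
  obtain rfl | hip := eq_or_ne i p
  · simpa using hlt.le
  have hiq : i ≠ q := fun h => hq (h ▸ (Finset.mem_filter.1 hi).2)
  simp [Equiv.swap_apply_of_ne_of_ne hip hiq]

end Arrangement

section Spanning

variable {k : Type*} [Field k] {r n m : ℕ}

/-- The symmetrization of the tensor of columns in the order given by `π`. -/
def symmTensor (m : ℕ) (v : Matrix (Fin r) (Fin n) k) (π : Equiv.Perm (Fin n)) :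
    PiTensorProduct k fun _ : Fin n => Fin r → k :=
  symmetrizer k r n m (PiTensorProduct.tprod k ((fun j i => v i j) ∘ π))

theorem symmetrizer_permAct_vtens (v : Matrix (Fin r) (Fin n) k) (π : Equiv.Perm (Fin n)) :
    symmetrizer k r n m (permAct k π (vtens k v)) = symmTensor m v π⁻¹ := by
  simp only [permAct, vtens, LinearEquiv.coe_coe, PiTensorProduct.reindex_tprod]
  rfl

theorem symmTensor_mem_of_nbc [CharZero k] (hm : m ≤ n) (v : Matrix (Fin r) (Fin n) k)
    (W : Submodule k (PiTensorProduct k fun _ : Fin n => Fin r → k))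
    (hW : ∀ S : Finset (Fin n), S.card = m → IsNbc k v S →
      ∃ π : Equiv.Perm (Fin n), headSet m π = S ∧ symmTensor m v π ∈ W)
    (π : Equiv.Perm (Fin n)) : symmTensor m v π ∈ W := by
  induction h : ∑ j ∈ headSet m π, (j : ℕ) using Nat.strong_induction_on generalizing π with
  | h N ih =>
    subst h
    by_cases hnbc : IsNbc k v (headSet m π)
    · obtain ⟨π', hπ', hmem⟩ := hW _ (card_headSet hm π) hnbc
      have hρ : ∀ i : Fin n, ((π'⁻¹ * π) i : ℕ) < m ↔ (i : ℕ) < m := fun i => by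
        rw [Equiv.Perm.mul_apply, ← mem_headSet, hπ', apply_mem_headSet]
      obtain ⟨ε, hε⟩ := exists_symmetrizer_tprod_comp_eq_smul (k := k)
        ((fun j i => v i j) ∘ π') hρ
      rw [Function.comp_assoc, ← Equiv.Perm.coe_mul, mul_inv_cancel_left] at hε
      rw [symmTensor, hε]
      exact W.smul_mem _ hmem
    · simp only [IsNbc, not_forall, not_not] at hnbc
      obtain ⟨_, ⟨C, hC, hne, rfl⟩, hsub⟩ := hnbc
      set c := C.min' hne with hc
      obtain ⟨b, hb⟩ := hC.exists_eq_sum (C.min'_mem hne)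
      set P := (C.erase c).map (π⁻¹).toEmbedding with hP
      have hPm : ∀ p ∈ P, (p : ℕ) < m := by
        intro p hp
        obtain ⟨j, hj, rfl⟩ := Finset.mem_map.1 hp
        exact mem_headSet.1 (hsub hj)
      have hw : ((fun j i => v i j) ∘ π) (π⁻¹ c) =
          ∑ p ∈ P, b (π p) • ((fun j i => v i j) ∘ π) p := by
        rw [hP, Finset.sum_map]
        simpa using hb
      by_cases hq : ((π⁻¹ c : Fin n) : ℕ) < m
      · rw [symmTensor, symmetrizer_tprod_eq_zero_of_eq_sum hq hPm ?_ (b := b ∘ π) hw]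
        · exact W.zero_mem
        · simp [hP]
      · rw [symmTensor, symmetrizer_tprod_eq_sum_swap hq hPm (b := b ∘ π) hw]
        refine W.sum_mem fun p hp => ?_
        rw [Function.comp_assoc, ← Equiv.Perm.coe_mul]
        refine ih _ (sum_headSet_swap_lt (hPm p hp) hq ?_) _ rfl
        obtain ⟨j, hj, rfl⟩ := Finset.mem_map.1 hp
        simpa using C.min'_lt_of_mem_erase_min' hne hj

end Spanning

section Independence

open Polynomial

variable {k : Type*} [Field k] {r n m : ℕ}

theorem coeff_sum_prod_of_forall_lt {ι : Type*} (s : Finset ι) (f : ι → k[X]) (a : ι → ℕ)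
    (h : ∀ i ∈ s, ∀ q < a i, (f i).coeff q = 0) :
    (∏ i ∈ s, f i).coeff (∑ i ∈ s, a i) = ∏ i ∈ s, (f i).coeff (a i) := by
  choose! g hg using fun i hi => X_pow_dvd_iff.2 (h i hi)
  rw [Finset.prod_congr rfl hg, Finset.prod_mul_distrib, Finset.prod_pow_eq_pow_sum,
    coeff_X_pow_mul', if_pos le_rfl, Nat.sub_self, coeff_zero_prod]
  refine Finset.prod_congr rfl fun i hi => ?_
  rw [hg i hi, coeff_X_pow_mul', if_pos le_rfl, Nat.sub_self]

theorem exists_basis_natAdd {V : Type*} [AddCommGroup V] [Module k V] [FiniteDimensional k V]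
    {u : Fin m → V} (hu : LinearIndependent k u) :
    ∃ (d : ℕ) (b : Module.Basis (Fin (d + m)) k V), ∀ p, b (Fin.natAdd d p) = u p := by
  let b₀ := Module.Basis.sumExtend hu
  have hfin : Finite (Fin m ⊕ Module.Basis.sumExtendIndex hu) := Module.Finite.finite_basis b₀
  have : Finite (Module.Basis.sumExtendIndex hu) := Finite.sum_right (Fin m)
  obtain ⟨d, ⟨e⟩⟩ := Finite.exists_equiv_fin (Module.Basis.sumExtendIndex hu)
  refine ⟨d, b₀.reindex ((Equiv.sumComm _ _).trans
    ((Equiv.sumCongr e (Equiv.refl _)).trans finSumFinEquiv)), fun p => ?_⟩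
  simp only [b₀, Module.Basis.sumExtend, Module.Basis.reindex_apply, Module.Basis.extend_apply_self,
    Equiv.symm_trans_apply, finSumFinEquiv_symm_apply_natAdd, Equiv.sumCongr_symm,
    Equiv.sumCongr_apply, Sum.map_inr, Equiv.refl_symm, Equiv.refl_apply, Equiv.sumComm_symm,
    Equiv.sumComm_apply, Sum.swap_inr]
  classical
  exact congrArg Subtype.val (Equiv.Set.sumDiffSubset_apply_inl
    (hu.linearIndepOn_id.subset_extend (Set.subset_univ _)) (Equiv.ofInjective u hu.injective p))

variable {V : Type*} [AddCommGroup V] [Module k V] {d : ℕ}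

/-- The generating polynomial of the coordinates of a vector. -/
def coordPoly {e : ℕ} (b : Module.Basis (Fin e) k V) : V →ₗ[k] k[X] :=
  ∑ q : Fin e, (monomial (q : ℕ)).comp (b.coord q)

theorem coeff_coordPoly {e : ℕ} (b : Module.Basis (Fin e) k V) (x : V) (q : Fin e) :
    (coordPoly b x).coeff q = b.coord q x := by
  simp [coordPoly, coeff_monomial, Fin.val_inj]

theorem coordPoly_ne_zero {e : ℕ} (b : Module.Basis (Fin e) k V) {x : V} (hx : x ≠ 0) :
    coordPoly b x ≠ 0 := by
  refine fun h => hx (b.ext_elem fun q => ?_)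
  have := coeff_coordPoly b x q
  rw [h, coeff_zero] at this
  simpa using this.symm

/-- The part of `coordPoly` extracted at position `i`: a single coordinate for the first `m`
positions, all of it for the remaining ones. -/
def posPoly (b : Module.Basis (Fin (d + m)) k V) (i : Fin n) : V →ₗ[k] k[X] :=
  if h : (i : ℕ) < m then (monomial (d + i)).comp (b.coord (Fin.natAdd d ⟨i, h⟩))
  else coordPoly b

theorem coeff_posPoly_of_lt (b : Module.Basis (Fin (d + m)) k V) {i : Fin n} (h : (i : ℕ) < m)
    (x : V) (q : ℕ) :
    (posPoly b i x).coeff q = if q = d + i then (coordPoly b x).coeff q else 0 := by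
  have := coeff_coordPoly b x (Fin.natAdd d ⟨i, h⟩)
  rw [Fin.val_natAdd] at this
  rw [posPoly, dif_pos h, LinearMap.comp_apply, coeff_monomial]
  by_cases hq : q = d + i
  · rw [if_pos hq, if_pos hq.symm, hq, ← this]
  · rw [if_neg hq, if_neg (Ne.symm hq)]

theorem posPoly_of_not_lt (b : Module.Basis (Fin (d + m)) k V) {i : Fin n} (h : ¬ (i : ℕ) < m) :
    posPoly b i = coordPoly b :=
  dif_neg h

theorem coeff_posPoly_of_lt_natTrailingDegree (b : Module.Basis (Fin (d + m)) k V) (i : Fin n)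
    (x : V) {q : ℕ} (hq : q < (coordPoly b x).natTrailingDegree) :
    (posPoly b i x).coeff q = 0 := by
  by_cases h : (i : ℕ) < m
  · rw [coeff_posPoly_of_lt b h, coeff_eq_zero_of_lt_natTrailingDegree hq, ite_self]
  · rw [posPoly_of_not_lt b h, coeff_eq_zero_of_lt_natTrailingDegree hq]

/-- The lowest coefficient, on arrangements of the columns of `v`, of the product of the
`posPoly`. -/
def lowestCoeff (b : Module.Basis (Fin (d + m)) k (Fin r → k)) (v : Matrix (Fin r) (Fin n) k) :
    (PiTensorProduct k fun _ : Fin n => Fin r → k) →ₗ[k] k :=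
  (lcoeff k (∑ j, (coordPoly b fun i => v i j).natTrailingDegree)).comp
    (PiTensorProduct.lift ((MultilinearMap.mkPiAlgebra k (Fin n) k[X]).compLinearMap (posPoly b)))

theorem lowestCoeff_tprod (b : Module.Basis (Fin (d + m)) k (Fin r → k))
    (v : Matrix (Fin r) (Fin n) k) (ρ : Equiv.Perm (Fin n)) :
    lowestCoeff b v (PiTensorProduct.tprod k ((fun j i => v i j) ∘ ρ)) =
      ∏ i, (posPoly b i fun l => v l (ρ i)).coeff
        (coordPoly b fun l => v l (ρ i)).natTrailingDegree := by
  rw [lowestCoeff, LinearMap.comp_apply, PiTensorProduct.lift.tprod,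
    MultilinearMap.compLinearMap_apply, MultilinearMap.mkPiAlgebra_apply, lcoeff_apply,
    ← Equiv.sum_comp ρ]
  exact coeff_sum_prod_of_forall_lt _ _ _ fun i _ q hq =>
    coeff_posPoly_of_lt_natTrailingDegree b i _ hq

/-- Extracting a nonzero lowest coefficient forces the head of the arrangement. -/
theorem eq_of_lowestCoeff_ne_zero (hm : m ≤ n) {v : Matrix (Fin r) (Fin n) k}
    {S : Finset (Fin n)} (hS : S.card = m) (hSnbc : IsNbc k v S)
    {b : Module.Basis (Fin (d + m)) k (Fin r → k)}
    (hb : ∀ p, b (Fin.natAdd d p) = fun i => v i (S.orderEmbOfFin hS p))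
    {ρ : Equiv.Perm (Fin n)} (hρ : IsNbc k v (headSet m ρ))
    (hne : lowestCoeff b v (PiTensorProduct.tprod k ((fun j i => v i j) ∘ ρ)) ≠ 0) (p : Fin m) :
    ρ (Fin.castLE hm p) = S.orderEmbOfFin hS p := by
  rw [lowestCoeff_tprod, Finset.prod_ne_zero_iff] at hne
  have hp : ∀ p : Fin m,
      (coordPoly b fun l => v l (ρ (Fin.castLE hm p))).natTrailingDegree = d + p ∧
      (coordPoly b fun l => v l (ρ (Fin.castLE hm p))).coeff (d + p) ≠ 0 := by
    intro p
    have h := hne (Fin.castLE hm p) (Finset.mem_univ _)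
    rw [coeff_posPoly_of_lt b (by simp)] at h
    have h' := (ite_ne_right_iff.1 h)
    rw [Fin.val_castLE] at h'
    exact ⟨h'.1, h'.1 ▸ h'.2⟩
  have hcoord : ∀ p q : Fin m, (coordPoly b fun l => v l (ρ (Fin.castLE hm p))).coeff (d + q) =
      b.coord (Fin.natAdd d q) fun l => v l (ρ (Fin.castLE hm p)) := fun p q => by
    rw [← coeff_coordPoly, Fin.val_natAdd]
  refine congrFun (hSnbc.eq_of_adapted hρ (s := S.orderEmbOfFin hS)
    (t := fun p => ρ (Fin.castLE hm p)) (S.orderEmbOfFin hS).strictMono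
    (fun p => S.orderEmbOfFin_mem hS p) (fun p => apply_mem_headSet.2 (by simp))
    (fun p q => b.coord (Fin.natAdd d q) fun l => v l (ρ (Fin.castLE hm p)))
    (fun p => by rw [← hcoord]; exact (hp p).2) fun p => ?_) p
  have hlow : ∀ q : Fin (d + m), (q : ℕ) < d + p →
      b.coord q (fun l => v l (ρ (Fin.castLE hm p))) = 0 := fun q hq => by
    rw [← coeff_coordPoly]
    exact coeff_eq_zero_of_lt_natTrailingDegree ((hp p).1.symm ▸ hq)
  conv_lhs => rw [← b.sum_repr fun i => v i (ρ (Fin.castLE hm p)), Fin.sum_univ_add]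
  rw [Finset.sum_eq_zero fun q _ => ?_, zero_add]
  · rw [eq_comm]
    refine (Finset.sum_subset (Finset.subset_univ _) fun q _ hq => ?_).trans
      (Finset.sum_congr rfl fun q _ => ?_)
    · rw [hlow _ (by simpa using hq), zero_smul]
    · rw [hb, Module.Basis.coord_apply]
  · rw [← Module.Basis.coord_apply, hlow _ (by simp; omega), zero_smul]

theorem IsNbc.column_ne_zero {v : Matrix (Fin r) (Fin n) k} {S : Finset (Fin n)}
    (hS : IsNbc k v S) (j : Fin n) : (fun i => v i j) ≠ 0 := fun h =>
  hS.notMem_span (Finset.empty_subset S) (c := j) (by simp) (by simp [h])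

theorem lowestCoeff_symmTensor_eq_zero (hm : m ≤ n) {v : Matrix (Fin r) (Fin n) k}
    {S : Finset (Fin n)} (hS : S.card = m) (hSnbc : IsNbc k v S)
    {b : Module.Basis (Fin (d + m)) k (Fin r → k)}
    (hb : ∀ p, b (Fin.natAdd d p) = fun i => v i (S.orderEmbOfFin hS p))
    {π : Equiv.Perm (Fin n)} (hπ : IsNbc k v (headSet m π)) (hne : headSet m π ≠ S) :
    lowestCoeff b v (symmTensor m v π) = 0 := by
  rw [symmTensor, symmetrizer_tprod]
  simp only [map_sum, map_smul]
  refine Finset.sum_eq_zero fun σ hσ => Finset.sum_eq_zero fun τ hτ => ?_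
  rw [Function.comp_assoc, ← Equiv.Perm.coe_mul]
  have hhead := headSet_mul_inv (π := π) (Finset.mem_filter.1 hσ).2 (Finset.mem_filter.1 hτ).2
  by_contra h
  refine hne (hhead ▸ headSet_eq_of_orderEmbOfFin hm
    (eq_of_lowestCoeff_ne_zero hm hS hSnbc hb (by rwa [hhead]) (right_ne_zero_of_smul h)))

theorem coordPoly_basis {e : ℕ} (b : Module.Basis (Fin e) k V) (q : Fin e) :
    coordPoly b (b q) = monomial (q : ℕ) 1 := by
  classical
  simp only [coordPoly, LinearMap.sum_apply, LinearMap.comp_apply, Module.Basis.coord_apply,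
    Module.Basis.repr_self]
  rw [Finset.sum_eq_single_of_mem q (Finset.mem_univ _), Finsupp.single_eq_same]
  intro q' _ hne
  rw [Finsupp.single_eq_of_ne hne, map_zero]

theorem lowestCoeff_tprod_of_head (hm : m ≤ n) {v : Matrix (Fin r) (Fin n) k}
    {b : Module.Basis (Fin (d + m)) k (Fin r → k)} {ρ : Equiv.Perm (Fin n)}
    (hb : ∀ p, b (Fin.natAdd d p) = fun i => v i (ρ (Fin.castLE hm p))) :
    lowestCoeff b v (PiTensorProduct.tprod k ((fun j i => v i j) ∘ ρ)) =
      ∏ j, (coordPoly b fun l => v l j).trailingCoeff := by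
  rw [lowestCoeff_tprod, ← Equiv.prod_comp ρ fun j => (coordPoly b fun l => v l j).trailingCoeff]
  refine Finset.prod_congr rfl fun i _ => ?_
  by_cases hi : (i : ℕ) < m
  · have h := coordPoly_basis b (Fin.natAdd d ⟨i, hi⟩)
    rw [hb, Fin.val_natAdd] at h
    have h' : (coordPoly b fun l => v l (ρ i)) = monomial (d + i) 1 := h
    rw [coeff_posPoly_of_lt b hi, h', natTrailingDegree_monomial one_ne_zero, if_pos rfl,
      trailingCoeff, natTrailingDegree_monomial one_ne_zero]
  · rw [posPoly_of_not_lt b hi, trailingCoeff]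

theorem lowestCoeff_symmTensor_ne_zero [CharZero k] (hm : m ≤ n) {v : Matrix (Fin r) (Fin n) k}
    {S : Finset (Fin n)} (hS : S.card = m) (hSnbc : IsNbc k v S)
    {b : Module.Basis (Fin (d + m)) k (Fin r → k)}
    (hb : ∀ p, b (Fin.natAdd d p) = fun i => v i (S.orderEmbOfFin hS p))
    {π : Equiv.Perm (Fin n)} (hπ : ∀ p, π (Fin.castLE hm p) = S.orderEmbOfFin hS p) :
    lowestCoeff b v (symmTensor m v π) ≠ 0 := by
  have hfix : ∀ {τ : Equiv.Perm (Fin n)}, (∀ i : Fin n, (i : ℕ) < m → τ i = i) →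
      lowestCoeff b v (PiTensorProduct.tprod k ((fun j i => v i j) ∘ ⇑(π * τ⁻¹))) =
        ∏ j, (coordPoly b fun l => v l j).trailingCoeff := fun {τ} hτ =>
    lowestCoeff_tprod_of_head hm fun p => by
      rw [hb, Equiv.Perm.mul_apply, fixes_inv hτ _ (by simp), hπ]
  have hhead := headSet_eq_of_orderEmbOfFin hm hπ
  rw [symmTensor, symmetrizer_tprod]
  simp only [map_sum, map_smul, Function.comp_assoc, ← Equiv.Perm.coe_mul]
  rw [Finset.sum_eq_single_of_mem 1 (by simp)]
  · rw [Finset.sum_congr rfl fun τ hτ => by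
      rw [one_mul, hfix (Finset.mem_filter.1 hτ).2, Equiv.Perm.sign_one, Units.val_one,
        Int.cast_one, one_smul], Finset.sum_const]
    refine smul_ne_zero (Finset.card_ne_zero_of_mem (a := 1) (by simp))
      (Finset.prod_ne_zero_iff.2 fun j _ => ?_)
    rw [Ne, trailingCoeff_eq_zero]
    exact coordPoly_ne_zero b (hSnbc.column_ne_zero j)
  · intro σ hσ hne
    have hσ' := (Finset.mem_filter.1 hσ).2
    refine Finset.sum_eq_zero fun τ hτ => ?_
    have hτ' := (Finset.mem_filter.1 hτ).2
    by_contra h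
    have heq := eq_of_lowestCoeff_ne_zero hm hS hSnbc hb
      (by rwa [headSet_mul_inv hσ' hτ', hhead]) (right_ne_zero_of_smul h)
    refine hne (Equiv.ext fun i => ?_)
    by_cases hi : (i : ℕ) < m
    · have hi' := (heq ⟨i, hi⟩).trans (hπ ⟨i, hi⟩).symm
      rw [Equiv.Perm.mul_apply] at hi'
      have hστ := Equiv.Perm.inv_eq_iff_eq.1 (π.injective hi')
      rw [Equiv.Perm.mul_apply, hτ' _ (by simpa using hi)] at hστ
      exact hστ.symm
    · exact hσ' i hi

end Independence

theorem linearIndependent_symmTensor {k : Type*} [Field k] [CharZero k] {r n m : ℕ} (hm : m ≤ n)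
    (v : Matrix (Fin r) (Fin n) k)
    (π : {S : Finset (Fin n) // S.card = m ∧ IsNbc k v S} → Equiv.Perm (Fin n))
    (hπ : ∀ S p, π S (Fin.castLE hm p) = S.1.orderEmbOfFin S.2.1 p) :
    LinearIndependent k fun S => symmTensor m v (π S) := by
  classical
  rw [Fintype.linearIndependent_iff]
  intro g hg S
  have hind : LinearIndependent k fun p : Fin m => fun i => v i (S.1.orderEmbOfFin S.2.1 p) :=
    (colsIndep_iff_linearIndepOn.1 S.2.2.colsIndep).linearIndependent.comp
      (fun p => ⟨S.1.orderEmbOfFin S.2.1 p, S.1.orderEmbOfFin_mem S.2.1 p⟩)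
      fun p q h => (S.1.orderEmbOfFin S.2.1).injective (congrArg Subtype.val h)
  obtain ⟨d, b, hb⟩ := exists_basis_natAdd hind
  have h := congrArg (lowestCoeff b v) hg
  rw [map_sum, map_zero, Finset.sum_eq_single_of_mem S (Finset.mem_univ _), map_smul] at h
  · exact (smul_eq_zero.1 h).resolve_right
      (lowestCoeff_symmTensor_ne_zero hm S.2.1 S.2.2 hb (hπ S))
  · intro S' _ hne
    have hhead := headSet_eq_of_orderEmbOfFin hm (hπ S')
    rw [map_smul, lowestCoeff_symmTensor_eq_zero hm S.2.1 S.2.2 hb (by rw [hhead]; exact S'.2.2)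
      (by rw [hhead]; exact fun h => hne (Subtype.ext h)), smul_zero]

/-- The dimension of `e_m·𝔖(v)` equals the number of nbc subsets of size `m` of the
matroid of `v`. -/
theorem dim_symmetrized_module_eq_nbc_count
    {k : Type*} [Field k] [CharZero k] {r n : ℕ}
    (v : Matrix (Fin r) (Fin n) k) (m : ℕ) (hm : m ≤ n) :
    Module.finrank k
        ↥(Submodule.span k {x | ∃ π : Equiv.Perm (Fin n),
            x = symmetrizer k r n m (permAct k π (vtens k v))}) =
      Nat.card {S : Finset (Fin n) // S.card = m ∧ IsNbc k v S} := by
  classical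
  choose π hπ using fun S : {S : Finset (Fin n) // S.card = m ∧ IsNbc k v S} =>
    exists_arrangement hm S.1 S.2.1
  have hspan : Submodule.span k {x | ∃ π : Equiv.Perm (Fin n),
      x = symmetrizer k r n m (permAct k π (vtens k v))} =
      Submodule.span k (Set.range fun S => symmTensor m v (π S)) := by
    refine le_antisymm (Submodule.span_le.2 ?_) (Submodule.span_mono ?_)
    · rintro _ ⟨ρ, rfl⟩
      rw [symmetrizer_permAct_vtens]
      refine symmTensor_mem_of_nbc hm v _ (fun S hS hnbc => ?_) _
      exact ⟨π ⟨S, hS, hnbc⟩, headSet_eq_of_orderEmbOfFin hm (hπ ⟨S, hS, hnbc⟩),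
        Submodule.subset_span ⟨⟨S, hS, hnbc⟩, rfl⟩⟩
    · rintro _ ⟨S, rfl⟩
      exact ⟨(π S)⁻¹, by rw [symmetrizer_permAct_vtens, inv_inv]⟩
  rw [hspan, finrank_span_eq_card (linearIndependent_symmTensor hm v π hπ),
    Nat.card_eq_fintype_card]
end
end

section
/- Let n ≥ 1, 1 ≤ r ≤ n, and let B ⊆ {1,…,n} with |B| = r. In the field ℚ(t_1,…,t_n) of rational functions in n indeterminates, ∑_σ ∏_{s=1}^{n−1} (t_{σ(s+1)} − t_{σ(s)})^{-1} = ∑_{b ∈ B} (∏_{i ∈ B, i ≠ b} (t_b − t_i)^{-1}) · (∏_{j ∉ B} (t_j − t_b)^{-1}), where on the left σ ranges over all permutations of {1,…,n} such that {σ(1),…,σ(r)} = B. -/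
noncomputable section

open MvPolynomial

/-- The image of the variable `t_j` in the field `ℚ(t_1,…,t_n)`. -/
def tvar {n : ℕ} (j : Fin n) : FractionRing (MvPolynomial (Fin n) ℚ) :=
  algebraMap (MvPolynomial (Fin n) ℚ) (FractionRing (MvPolynomial (Fin n) ℚ)) (X j)

open Finset in
/-- Partial fractions: Lagrange interpolation of the constant `1` at the nodes `t c`, evaluated at
the further point `t b`. -/
theorem sum_inv_sub_mul_prod_erase {α K : Type*} [DecidableEq α] [Field K] {t : α → K}
    (ht : Function.Injective t) {S : Finset α} (hS : S.Nonempty) {b : α} (hb : b ∉ S) :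
    ∑ c ∈ S, (t c - t b)⁻¹ * ∏ j ∈ S.erase c, (t j - t c)⁻¹ = ∏ j ∈ S, (t j - t b)⁻¹ := by
  have key := congrArg (Polynomial.eval (t b)) (Lagrange.sum_basis (ht.injOn (s := S)) hS)
  rw [Polynomial.eval_finsetSum, Polynomial.eval_one] at key
  rw [← mul_one (∏ j ∈ S, (t j - t b)⁻¹), ← key, mul_sum]
  refine sum_congr rfl fun c hc => ?_
  rw [← mul_prod_erase _ _ hc, mul_assoc, Lagrange.basis, Polynomial.eval_prod,
    ← prod_mul_distrib]
  congr 1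
  refine prod_congr rfl fun j hj => ?_
  have hjb : t j - t b ≠ 0 :=
    sub_ne_zero.2 fun h => hb (ht h ▸ (mem_erase.1 hj).2)
  have hjc : t j - t c ≠ 0 := sub_ne_zero.2 fun h => (mem_erase.1 hj).1 (ht h)
  have hcj : t c - t j ≠ 0 := sub_ne_zero.2 fun h => (mem_erase.1 hj).1 (ht h).symm
  simp only [Lagrange.basisDivisor, Polynomial.eval_mul, Polynomial.eval_C, Polynomial.eval_sub,
    Polynomial.eval_X]
  field_simp
  ring

/-- The product of `k a b` over the pairs of consecutive entries `a, b` of a list. -/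
def pathWeight {α K : Type*} [Monoid K] (k : α → α → K) : List α → K
  | [] => 1
  | [_] => 1
  | a :: b :: l => k a b * pathWeight k (b :: l)

theorem pathWeight_append_cons {α K : Type*} [Monoid K] (k : α → α → K) (l₁ : List α) (b : α)
    (l₂ : List α) :
    pathWeight k (l₁ ++ b :: l₂) = pathWeight k (l₁ ++ [b]) * pathWeight k (b :: l₂) := by
  induction l₁ with
  | nil => simp [pathWeight]
  | cons a l ih =>
    cases l with
    | nil => simp [pathWeight]
    | cons c l => simpa [pathWeight, mul_assoc] using congrArg (k a c * ·) ih

theorem pathWeight_reverse {α K : Type*} [CommMonoid K] (k : α → α → K) (l : List α) :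
    pathWeight k l.reverse = pathWeight (fun a b => k b a) l := by
  induction l with
  | nil => simp [pathWeight]
  | cons a l ih =>
    cases l with
    | nil => simp [pathWeight]
    | cons c l =>
      rw [List.reverse_cons] at ih
      rw [List.reverse_cons, List.reverse_cons, List.append_assoc, List.singleton_append,
        pathWeight_append_cons, ih]
      simp [pathWeight, mul_comm]

theorem pathWeight_ofFn {α K : Type*} [CommMonoid K] (k : α → α → K) {m : ℕ}
    (f : Fin (m + 1) → α) :
    pathWeight k (List.ofFn f) = ∏ s : Fin m, k (f s.castSucc) (f s.succ) := by
  induction m with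
  | zero => simp [pathWeight]
  | succ m ih =>
    have h := ih fun i => f i.succ
    rw [List.ofFn_succ] at h
    rw [List.ofFn_succ, List.ofFn_succ, Fin.prod_univ_succ, pathWeight, h]
    rfl

/-- The finset of all orderings of `S`, as lists without repetition. -/
def Finset.orderings {α : Type*} [DecidableEq α] (S : Finset α) : Finset (List α) :=
  S.val.lists.toFinset

theorem Finset.mem_orderings {α : Type*} [DecidableEq α] {S : Finset α} {l : List α} :
    l ∈ S.orderings ↔ l.Nodup ∧ l.toFinset = S := by
  rw [Finset.orderings, Multiset.mem_toFinset, Multiset.mem_lists_iff]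
  constructor
  · intro h
    have hl : l.Nodup := by
      have := S.nodup
      rwa [h] at this
    refine ⟨hl, Finset.val_injective ?_⟩
    rw [h, List.toFinset_val, hl.dedup]
    rfl
  · rintro ⟨hl, rfl⟩
    rw [List.toFinset_val, hl.dedup]
    rfl

theorem Finset.sum_orderings {α M : Type*} [DecidableEq α] [AddCommMonoid M] {S : Finset α}
    (hS : S.Nonempty) (f : List α → M) :
    ∑ l ∈ S.orderings, f l = ∑ c ∈ S, ∑ l ∈ (S.erase c).orderings, f (c :: l) := by
  rw [Finset.sum_sigma']
  symm
  refine Finset.sum_bij (fun p _ => p.1 :: p.2) ?_ ?_ ?_ fun _ _ => rfl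
  · rintro ⟨c, l⟩ h
    simp only [Finset.mem_sigma, Finset.mem_orderings] at h ⊢
    obtain ⟨hc, hl, hlS⟩ := h
    refine ⟨List.nodup_cons.2 ⟨?_, hl⟩, ?_⟩
    · rw [← List.mem_toFinset, hlS]
      simp
    · rw [List.toFinset_cons, hlS, Finset.insert_erase hc]
  · rintro ⟨c, l⟩ _ ⟨c', l'⟩ _ h
    simp only [List.cons.injEq] at h
    obtain ⟨rfl, rfl⟩ := h
    rfl
  · intro l h
    rw [Finset.mem_orderings] at h
    obtain ⟨hl, rfl⟩ := h
    cases l with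
    | nil => simp at hS
    | cons c l =>
      have hc := List.nodup_cons.1 hl
      refine ⟨⟨c, l⟩, ?_, rfl⟩
      simp only [Finset.mem_sigma, Finset.mem_orderings]
      refine ⟨by simp, hc.2, ?_⟩
      rw [List.toFinset_cons, Finset.erase_insert (by simpa using hc.1)]

theorem sum_pathWeight_cons {α K : Type*} [DecidableEq α] [Field K] {t : α → K}
    (ht : Function.Injective t) (S : Finset α) {b : α} (hb : b ∉ S) :
    ∑ l ∈ S.orderings, pathWeight (fun a c => (t c - t a)⁻¹) (b :: l) =
      ∏ j ∈ S, (t j - t b)⁻¹ := by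
  induction S using Finset.strongInduction generalizing b with
  | H S ih =>
    obtain rfl | hS := S.eq_empty_or_nonempty
    · have h : (∅ : Finset α).orderings = {[]} := by
        ext l
        simp [Finset.mem_orderings, List.toFinset_eq_empty_iff]
        rintro rfl
        simp
      simp [h, pathWeight]
    · rw [Finset.sum_orderings hS, ← sum_inv_sub_mul_prod_erase ht hS hb]
      refine Finset.sum_congr rfl fun c hc => ?_
      rw [← ih _ (Finset.erase_ssubset hc) (Finset.notMem_erase c S), Finset.mul_sum]
      rfl

theorem List.toFinset_take_ofFn {n : ℕ} {α : Type*} [DecidableEq α] (f : Fin n → α) (r : ℕ) :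
    ((List.ofFn f).take r).toFinset =
      (Finset.univ.filter fun j : Fin n => (j : ℕ) < r).image f := by
  ext x
  simp only [List.mem_toFinset, List.mem_take_iff_getElem, Finset.mem_image, Finset.mem_filter,
    Finset.mem_univ, true_and, List.getElem_ofFn, List.length_ofFn]
  constructor
  · rintro ⟨i, hi, rfl⟩
    exact ⟨⟨i, by omega⟩, by simp; omega, rfl⟩
  · rintro ⟨j, hj, rfl⟩
    exact ⟨j, by omega, rfl⟩

theorem sum_perm_eq_sum_orderings {n : ℕ} {M : Type*} [AddCommMonoid M] (B : Finset (Fin n))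
    (f : List (Fin n) → M) :
    ∑ σ ∈ Finset.univ.filter (fun σ : Equiv.Perm (Fin n) =>
        (Finset.univ.filter fun j : Fin n => (j : ℕ) < B.card).image σ = B),
      f (List.ofFn σ) =
      ∑ l₁ ∈ B.orderings, ∑ l₂ ∈ Bᶜ.orderings, f (l₁.reverse ++ l₂) := by
  rw [← Finset.sum_product']
  refine Finset.sum_bij
    (fun σ _ => (((List.ofFn σ).take B.card).reverse, (List.ofFn σ).drop B.card)) ?_ ?_ ?_ ?_
  · intro σ h
    rw [Finset.mem_filter, ← List.toFinset_take_ofFn] at h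
    have hσ : (List.ofFn σ).Nodup := List.nodup_ofFn.2 σ.injective
    simp only [Finset.mem_product, Finset.mem_orderings, List.nodup_reverse,
      List.toFinset_reverse]
    refine ⟨⟨hσ.sublist (List.take_sublist _ _), h.2⟩, hσ.sublist (List.drop_sublist _ _), ?_⟩
    have hu : (List.ofFn σ).toFinset = Finset.univ := by
      ext x
      simpa [List.mem_ofFn] using σ.surjective x
    rw [← List.take_append_drop B.card (List.ofFn σ), List.toFinset_append, h.2] at hu
    have hd := List.disjoint_take_drop hσ (le_refl B.card)
    rw [← List.disjoint_toFinset_iff_disjoint, h.2] at hd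
    exact (IsCompl.of_eq hd.eq_bot hu).compl_eq.symm
  · intro σ _ τ _ h
    simp only [Prod.mk.injEq, List.reverse_inj] at h
    refine Equiv.coe_fn_injective (List.ofFn_injective ?_)
    rw [← List.take_append_drop B.card (List.ofFn σ), h.1, h.2, List.take_append_drop]
  · rintro ⟨l₁, l₂⟩ h
    simp only [Finset.mem_product, Finset.mem_orderings] at h
    obtain ⟨⟨h₁, rfl⟩, h₂, h₂B⟩ := h
    have hcard := List.toFinset_card_of_nodup h₁
    have hnodup : (l₁.reverse ++ l₂).Nodup := by
      refine (List.nodup_reverse.2 h₁).append h₂ ?_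
      rw [← List.disjoint_toFinset_iff_disjoint, List.toFinset_reverse, h₂B]
      exact disjoint_compl_right
    have hlen : (l₁.reverse ++ l₂).length = n := by
      rw [← List.toFinset_card_of_nodup hnodup, List.toFinset_append, List.toFinset_reverse, h₂B,
        Finset.union_compl, Finset.card_univ, Fintype.card_fin]
    have hinj : Function.Injective fun i : Fin n => (l₁.reverse ++ l₂).get (i.cast hlen.symm) :=
      (List.nodup_iff_injective_get.1 hnodup).comp (Fin.cast_injective _)
    have hof : List.ofFn (Equiv.ofBijective _ (Finite.injective_iff_bijective.1 hinj)) =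
        l₁.reverse ++ l₂ := by
      apply List.ext_getElem <;> simp [← hlen]
    have hl : l₁.toFinset.card = l₁.reverse.length := by rw [hcard, List.length_reverse]
    refine ⟨Equiv.ofBijective _ (Finite.injective_iff_bijective.1 hinj), ?_, ?_⟩
    · rw [Finset.mem_filter, ← List.toFinset_take_ofFn, hof, hl, List.take_left,
        List.toFinset_reverse]
      exact ⟨Finset.mem_univ _, rfl⟩
    · rw [hof, hl, List.take_left, List.drop_left, List.reverse_reverse]
  · intro σ _
    rw [List.reverse_reverse, List.take_append_drop]

theorem tvar_injective {n : ℕ} : Function.Injective (tvar (n := n)) :=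
  (IsFractionRing.injective _ _).comp X_injective

/-- The localization identity for the uniform matroid: the sum of
`∏_{s=1}^{n-1} (t_{σ(s+1)} − t_{σ(s)})⁻¹` over permutations whose lex-first basis is
`B` equals `∑_{b ∈ B} ∏_{i ∈ B∖b} (t_b − t_i)⁻¹ ∏_{j ∉ B} (t_j − t_b)⁻¹`. -/
theorem localization_sum_identity
    {n r : ℕ} (hn : 1 ≤ n) (hr : 1 ≤ r) (hrn : r ≤ n)
    (B : Finset (Fin n)) (hB : B.card = r) :
    (∑ σ ∈ Finset.univ.filter (fun σ : Equiv.Perm (Fin n) =>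
        (Finset.univ.filter fun j : Fin n => (j : ℕ) < r).image σ = B),
      ∏ s ∈ (Finset.range (n - 1)).attach,
        (tvar (σ ⟨s.1 + 1, by have := Finset.mem_range.mp s.2; omega⟩) -
          tvar (σ ⟨s.1, by have := Finset.mem_range.mp s.2; omega⟩))⁻¹) =
      ∑ b ∈ B,
        (∏ i ∈ B.erase b, (tvar b - tvar i)⁻¹) *
          ∏ j ∈ Bᶜ, (tvar j - tvar b)⁻¹ := by
  subst hB
  obtain ⟨m, rfl⟩ : ∃ m, n = m + 1 := ⟨n - 1, by omega⟩
  have hprod (σ : Equiv.Perm (Fin (m + 1))) :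
      ∏ s ∈ (Finset.range (m + 1 - 1)).attach,
        (tvar (σ ⟨s.1 + 1, Nat.succ_lt_succ (Finset.mem_range.1 s.2)⟩) -
          tvar (σ ⟨s.1, Nat.lt_succ_of_lt (Finset.mem_range.1 s.2)⟩))⁻¹ =
      pathWeight (fun a c => (tvar c - tvar a)⁻¹) (List.ofFn σ) := by
    rw [pathWeight_ofFn]
    refine Finset.prod_bij' (fun s _ => ⟨s.1, Finset.mem_range.1 s.2⟩)
      (fun s _ => ⟨s.1, Finset.mem_range.2 s.2⟩) ?_ ?_ ?_ ?_ ?_ <;> intros <;>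
      first | rfl | simp
  simp_rw [hprod]
  rw [sum_perm_eq_sum_orderings B, Finset.sum_orderings (Finset.card_pos.1 hr)]
  refine Finset.sum_congr rfl fun b hb => ?_
  have hneg : Function.Injective fun j : Fin (m + 1) => -tvar j :=
    neg_injective.comp tvar_injective
  have h₁ := sum_pathWeight_cons hneg (B.erase b) (Finset.notMem_erase b B)
  simp only [neg_sub_neg] at h₁
  rw [← sum_pathWeight_cons tvar_injective Bᶜ (by simpa using hb), ← h₁, Finset.sum_mul_sum]
  refine Finset.sum_congr rfl fun l₁ _ => Finset.sum_congr rfl fun l₂ _ => ?_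
  rw [List.reverse_cons, List.append_assoc, List.singleton_append, pathWeight_append_cons,
    ← List.reverse_cons, pathWeight_reverse]
end
end

section
/- Work in ℚ(t_1,…,t_n) and for a finite sequence (a_1,…,a_q) of distinct elements of {1,…,n} set f(a_1,…,a_q) = ∏_{s=1}^{q−1} (t_{a_{s+1}} − t_{a_s})^{-1} (with f of a one-term sequence equal to 1). Let ℓ = (ℓ_1,…,ℓ_m) be a sequence of distinct elements of {1,…,n}, let i ∈ {1,…,n} not appear in ℓ, let 1 ≤ p ≤ m, and set j = ℓ_p. Then ∑_{s=1}^{p} f(ℓ_1,…,ℓ_{s−1}, i, ℓ_s,…,ℓ_m) = f(ℓ_1,…,ℓ_m)/(t_j − t_i); that is, the sum of f over all sequences ℓ' obtained from ℓ by inserting i in a position preceding j equals f(ℓ) divided by t_j − t_i. -/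
noncomputable section

open MvPolynomial

/-- `f(a_1,…,a_q) = ∏_{s=1}^{q-1} (t_{a_{s+1}} − t_{a_s})⁻¹`, for a finite sequence
given as a list. -/
def fseq {n : ℕ} (L : List (Fin n)) : FractionRing (MvPolynomial (Fin n) ℚ) :=
  ((L.zip L.tail).map fun p => (tvar p.2 - tvar p.1)⁻¹).prod

theorem tvar_sub_ne_zero {n : ℕ} {a b : Fin n} (h : a ≠ b) : tvar a - tvar b ≠ 0 :=
  sub_ne_zero.mpr (tvar_injective.ne h)

theorem fseq_cons_cons {n : ℕ} (a b : Fin n) (L : List (Fin n)) :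
    fseq (a :: b :: L) = (tvar b - tvar a)⁻¹ * fseq (b :: L) := by
  simp [fseq]

theorem sum_fseq_insertIdx {n : ℕ} (i : Fin n) (k : ℕ) (L : List (Fin n)) (hL : L.Nodup)
    (hi : i ∉ L) (hk : k < L.length) :
    (∑ s ∈ Finset.range (k + 1), fseq (L.insertIdx s i)) =
      fseq L * (tvar L[k] - tvar i)⁻¹ := by
  induction k generalizing L with
  | zero =>
    obtain _ | ⟨a, l⟩ := L
    · simp at hk
    · simp [fseq_cons_cons, mul_comm]
  | succ k ih =>
    obtain _ | ⟨a, _ | ⟨b, l⟩⟩ := L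
    · simp at hk
    · simp at hk
    · have hk' : k < (b :: l).length := by simpa using hk
      have key := ih (b :: l) hL.of_cons (fun h => hi (List.mem_cons_of_mem a h)) hk'
      rw [Finset.sum_range_succ'] at key
      rw [Finset.sum_range_succ', Finset.sum_range_succ']
      simp only [List.insertIdx_succ_cons, List.insertIdx_zero, fseq_cons_cons,
        ← Finset.mul_sum, List.getElem_cons_succ] at key ⊢
      rw [eq_sub_of_add_eq key]
      have hai : tvar a - tvar i ≠ 0 := tvar_sub_ne_zero (by rintro rfl; simp at hi)
      have hia : tvar i - tvar a ≠ 0 := tvar_sub_ne_zero (by rintro rfl; simp at hi)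
      have hbi : tvar b - tvar i ≠ 0 := tvar_sub_ne_zero (by rintro rfl; simp at hi)
      have hba : tvar b - tvar a ≠ 0 := tvar_sub_ne_zero (by rintro rfl; simp at hL)
      have h_cancel : (tvar i - tvar a)⁻¹ * (tvar b - tvar i)⁻¹
          - (tvar b - tvar a)⁻¹ * (tvar b - tvar i)⁻¹
          + (tvar a - tvar i)⁻¹ * (tvar b - tvar a)⁻¹ = 0 := by
        rw [← neg_sub (tvar i) (tvar a), inv_neg]
        field_simp
        ring
      linear_combination fseq (b :: l) * h_cancel

/-- The telescoping insertion identity: summing `f` over all sequences obtained from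
`ℓ` by inserting `i` in a position preceding `ℓ_p` gives `f(ℓ)/(t_{ℓ_p} − t_i)`. -/
theorem telescoping_insertion_identity
    {n : ℕ} (L : List (Fin n)) (hL : L.Nodup) (i : Fin n) (hi : i ∉ L)
    (p : ℕ) (hp1 : 1 ≤ p) (hp2 : p ≤ L.length) :
    (∑ s ∈ Finset.range p, fseq (L.insertIdx s i)) =
      fseq L / (tvar (L.get ⟨p - 1, by omega⟩) - tvar i) := by
  obtain ⟨k, rfl⟩ := Nat.exists_eq_add_of_le' hp1
  simpa [div_eq_mul_inv] using sum_fseq_insertIdx i k L hL hi hp2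
end
end

section
/- Let r ≥ 1, n ≥ 0, and let λ_1,…,λ_r be nonnegative integers. In the polynomial ring ℤ[u_1,…,u_{r+1},t_1,…,t_n], ∑_{m=0}^{n} (−1)^m e_m(t_1,…,t_n) · det(A_m) = ∑_{ℓ=1}^{r+1} (−1)^{ℓ+r+1} (∏_{j=1}^{n} (1 − u_ℓ t_j)) · det(B_ℓ), where A_m is the (r+1)×(r+1) matrix whose (i,j) entry is u_i^{λ_j + r + 1 − j} for 1 ≤ j ≤ r and u_i^{m} for j = r+1, and B_ℓ is the r×r matrix with rows indexed by i ∈ {1,…,r+1}∖{ℓ} and (i,j) entry u_i^{λ_j + r + 1 − j} for 1 ≤ j ≤ r. (This is the identity underlying the fact that the raising operator ρ = ∑_k (−1)^k e_k(t) ρ_k computes the K-polynomial of the stabilization of a module under adding a row of zeros.) -/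
open MvPolynomial

noncomputable section

/-- The generating function `∏_j (1 - x y_j) = ∑_m (-1)^m e_m(y) x^m`. -/
theorem prod_one_sub_mul_eq_sum_esymm {R : Type*} [CommRing R] (n : ℕ) (x : R) (y : Fin n → R) :
    ∏ j, (1 - x * y j) = ∑ m ∈ Finset.range (n + 1),
      (-1) ^ m * (∑ S ∈ Finset.powersetCard m Finset.univ, ∏ j ∈ S, y j) * x ^ m := by
  simp_rw [sub_eq_add_neg, Finset.prod_one_add, Finset.sum_powerset, Finset.card_univ,
    Fintype.card_fin, Finset.mul_sum, Finset.sum_mul]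
  refine Finset.sum_congr rfl fun m _ => Finset.sum_congr rfl fun S hS => ?_
  rw [Finset.prod_neg, Finset.prod_mul_distrib, Finset.prod_const,
    (Finset.mem_powersetCard.mp hS).2]
  ring

/-- The determinantal identity underlying the raising operator
`ρ = ∑_k (−1)^k e_k(t) ρ_k`:
`∑_{m=0}^{n} (−1)^m e_m(t) det(A_m) = ∑_{ℓ=1}^{r+1} (−1)^{ℓ+r+1} ∏_j (1 − u_ℓ t_j) det(B_ℓ)`
in `ℤ[u_1,…,u_{r+1},t_1,…,t_n]`. -/
theorem raising_operator_determinantal_identity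
    (r n : ℕ) (hr : 1 ≤ r) (lam : Fin r → ℕ) :
    (∑ m ∈ Finset.range (n + 1),
      (-1 : MvPolynomial (Fin (r + 1) ⊕ Fin n) ℤ) ^ m *
        (∑ S ∈ Finset.powersetCard m (Finset.univ : Finset (Fin n)),
          ∏ j ∈ S, X (Sum.inr j)) *
        Matrix.det (Matrix.of fun i j : Fin (r + 1) =>
          (X (Sum.inl i) : MvPolynomial (Fin (r + 1) ⊕ Fin n) ℤ) ^
            (if h : (j : ℕ) < r then lam ⟨j, h⟩ + r - (j : ℕ) else m))) =
      ∑ l : Fin (r + 1),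
        (-1 : MvPolynomial (Fin (r + 1) ⊕ Fin n) ℤ) ^ ((l : ℕ) + r) *
          (∏ j : Fin n, (1 - X (Sum.inl l) * X (Sum.inr j))) *
          Matrix.det (Matrix.of fun i j : Fin r =>
            (X (Sum.inl (l.succAbove i)) : MvPolynomial (Fin (r + 1) ⊕ Fin n) ℤ) ^
              (lam j + r - (j : ℕ))) := by
  simp_rw [Matrix.det_succ_column _ (Fin.last r), prod_one_sub_mul_eq_sum_esymm,
    Finset.mul_sum, Finset.sum_mul]
  rw [Finset.sum_comm]
  refine Finset.sum_congr rfl fun l _ => Finset.sum_congr rfl fun m _ => ?_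
  simp only [Matrix.submatrix, Matrix.of_apply, Fin.succAbove_last, Fin.val_castSucc, Fin.is_lt,
    Fin.val_last, lt_irrefl, dite_true, dite_false, Fin.eta]
  rw [← Finset.sum_mul, ← Finset.sum_mul, ← Finset.mul_sum]
  ring
end
end
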